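/- arXiv:math/9806161 — 5 statements merged into one kernel-verified Lean document; each statement's English description precedes it below -/
import Mathlib

section
/- Let n be odd and let U₀, U₁, …, U_{n+1} be N×N complex unitary matrices with ‖Uₖ − Uₗ‖ < 1 for all k, l. Then the Alexander–Spanier coboundary of Chⁿ vanishes on these points: Σ_{j=0}^{n+1} (−1)ʲ Chⁿ(U₀, …, Ûⱼ, …, U_{n+1}) = 0, where Ûⱼ means that Uⱼ is omitted. -/
open scoped Matrix.Norms.L2Operator
open MeasureTheory

/-- The standard `n`-simplex `Δⁿ = {t ∈ ℝⁿ : tᵢ ≥ 0, Σᵢ tᵢ ≤ 1}`. -/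
def simplexΔ (n : ℕ) : Set (Fin n → ℝ) := {t | (∀ i, 0 ≤ t i) ∧ ∑ i, t i ≤ 1}

/-- `V(t) = Σⱼ₌₀ⁿ tⱼ Uⱼ`, with `t₀ = 1 − Σᵢ₌₁ⁿ tᵢ`. -/
noncomputable def simplexComb {n N : ℕ} (U : Fin (n + 1) → Matrix (Fin N) (Fin N) ℂ)
    (t : Fin n → ℝ) : Matrix (Fin N) (Fin N) ℂ :=
  (((1 - ∑ i, t i : ℝ)) : ℂ) • U 0 + ∑ i : Fin n, ((t i : ℝ) : ℂ) • U i.succ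

/-- The constant `cₙ = (−1)^((n−1)/2) ((n−1)/2)! / ((2πi)^((n+1)/2) n!)`. -/
noncomputable def oddChernConst (n : ℕ) : ℂ :=
  ((-1) ^ ((n - 1) / 2) * (Nat.factorial ((n - 1) / 2) : ℂ)) /
    ((2 * Real.pi * Complex.I) ^ ((n + 1) / 2) * (Nat.factorial n : ℂ))

/-- The odd Chern character cochain
`Chⁿ(U₀,…,Uₙ) = cₙ ∫_{Δⁿ} Σ_{σ∈Sₙ} sgn σ · tr(V(t)⁻¹δ_{σ(1)} ⋯ V(t)⁻¹δ_{σ(n)}) dt`,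
where `δⱼ = Uⱼ − U₀`. -/
noncomputable def chOdd (n N : ℕ) (U : Fin (n + 1) → Matrix (Fin N) (Fin N) ℂ) : ℂ :=
  oddChernConst n *
    ∫ t in simplexΔ n, ∑ σ : Equiv.Perm (Fin n),
      ((Equiv.Perm.sign σ : ℤ) : ℂ) *
        Matrix.trace
          (((List.finRange n).map fun i =>
              (simplexComb U t)⁻¹ * (U (σ i).succ - U 0)).prod)


/-- trace of an ordered product -/
noncomputable def trProd {N n : ℕ} (x : Fin n → Matrix (Fin N) (Fin N) ℂ) : ℂ :=
  Matrix.trace (List.ofFn x).prod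

/-- antisymmetrised trace, as an alternating map -/
noncomputable def altTr (N n : ℕ) : AlternatingMap ℂ (Matrix (Fin N) (Fin N) ℂ) ℂ (Fin n) :=
  MultilinearMap.alternatization
    ((Matrix.traceLinearMap (Fin N) ℂ ℂ).compMultilinearMap
      (MultilinearMap.mkPiAlgebraFin ℂ n (Matrix (Fin N) (Fin N) ℂ)))

lemma altTr_apply {N n : ℕ} (x : Fin n → Matrix (Fin N) (Fin N) ℂ) :
    altTr N n x = ∑ σ : Equiv.Perm (Fin n), ((Equiv.Perm.sign σ : ℤ) : ℂ) *
      trProd (fun i => x (σ i)) := by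
  simp [altTr, MultilinearMap.alternatization_apply, trProd, Units.smul_def]

lemma trProd_rotate {N n : ℕ} (x : Fin (n + 1) → Matrix (Fin N) (Fin N) ℂ) :
    trProd (fun i => x (finRotate (n + 1) i)) = trProd x := by
  unfold trProd
  rw [List.ofFn_succ' (f := fun i => x (finRotate (n + 1) i)), List.ofFn_succ (f := x)]
  simp only [List.concat_eq_append, List.prod_append, List.prod_cons, List.prod_nil, mul_one]
  rw [Matrix.trace_mul_comm]
  simp

lemma altTr_eq_zero {N n : ℕ} (hn : Odd n) (x : Fin (n + 1) → Matrix (Fin N) (Fin N) ℂ) :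
    altTr N (n + 1) x = 0 := by
  have h1 := (altTr N (n + 1)).map_perm x (finRotate (n + 1))
  have h2 : altTr N (n + 1) (x ∘ finRotate (n + 1)) = altTr N (n + 1) x := by
    rw [altTr_apply, altTr_apply]
    rw [← (MulAut.conj (finRotate (n + 1))⁻¹).toEquiv.sum_comp]
    refine Finset.sum_congr rfl fun σ _ => ?_
    congr 1
    · simp only [MulEquiv.toEquiv_eq_coe, MulEquiv.coe_toEquiv, MulAut.conj_apply, map_mul,
        Equiv.Perm.sign_inv, inv_inv]
      congr 1
      rw [mul_right_comm, Int.units_mul_self, one_mul]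
    · rw [← trProd_rotate (fun i => x (σ i))]
      simp
  rw [h2, sign_finRotate] at h1
  simp [hn.neg_one_pow] at h1
  exact self_eq_neg.mp h1

/-- the permutation sending `p` to `j` and otherwise acting as `σ` -/
def insPerm {n : ℕ} (p j : Fin (n + 1)) (σ : Equiv.Perm (Fin n)) : Equiv.Perm (Fin (n + 1)) :=
  (p.cycleRange.trans (Equiv.Perm.decomposeFin.symm (0, σ))).trans j.cycleRange.symm

lemma insPerm_self {n : ℕ} (p j : Fin (n + 1)) (σ : Equiv.Perm (Fin n)) :
    insPerm p j σ p = j := by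
  simp [insPerm]

lemma insPerm_succAbove {n : ℕ} (p j : Fin (n + 1)) (σ : Equiv.Perm (Fin n)) (i : Fin n) :
    insPerm p j σ (p.succAbove i) = j.succAbove (σ i) := by
  simp [insPerm]

lemma insPerm_sign {n : ℕ} (p j : Fin (n + 1)) (σ : Equiv.Perm (Fin n)) :
    ((Equiv.Perm.sign (insPerm p j σ) : ℤ) : ℂ) =
      (-1) ^ (p : ℕ) * ((-1) ^ (j : ℕ) * ((Equiv.Perm.sign σ : ℤ) : ℂ)) := by
  simp [insPerm, Equiv.Perm.sign_trans, Fin.sign_cycleRange]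
  ring

lemma insPerm_bij {n : ℕ} (p : Fin (n + 1)) :
    Function.Bijective (fun a : Fin (n + 1) × Equiv.Perm (Fin n) => insPerm p a.1 a.2) := by
  rw [Fintype.bijective_iff_injective_and_card]
  constructor
  · rintro ⟨j, σ⟩ ⟨j', σ'⟩ h
    simp only at h
    have h1 : j = j' := by rw [← insPerm_self p j σ, h, insPerm_self]
    subst h1
    congr 1
    ext i : 1
    apply j.succAbove_right_injective
    rw [← insPerm_succAbove p, h, insPerm_succAbove]
  · simp [Fintype.card_perm, Nat.factorial_succ]

lemma sum_insert_eq_zero {N n : ℕ} (hn : Odd n) (W : Fin (n + 1) → Matrix (Fin N) (Fin N) ℂ)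
    (p : Fin (n + 1)) :
    ∑ j : Fin (n + 1), (-1 : ℂ) ^ (j : ℕ) * ∑ σ : Equiv.Perm (Fin n),
      ((Equiv.Perm.sign σ : ℤ) : ℂ) *
        trProd (p.insertNth (α := fun _ => Matrix (Fin N) (Fin N) ℂ) (W j)
          (fun i => W (j.succAbove (σ i)))) = 0 := by
  have h := altTr_eq_zero hn W
  rw [altTr_apply, ← (Equiv.ofBijective _ (insPerm_bij p)).sum_comp, Fintype.sum_prod_type] at h
  have h3 := congrArg (fun z => (-1 : ℂ) ^ (p : ℕ) * z) h
  simp only [mul_zero] at h3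
  rw [← h3, Finset.mul_sum]
  refine Finset.sum_congr rfl fun j _ => ?_
  rw [Finset.mul_sum, Finset.mul_sum]
  refine Finset.sum_congr rfl fun σ _ => ?_
  simp only [Equiv.ofBijective_apply]
  rw [insPerm_sign]
  have e : (p.insertNth (α := fun _ => Matrix (Fin N) (Fin N) ℂ) (W j)
          (fun i => W (j.succAbove (σ i)))) = fun i => W (insPerm p j σ i) := by
    ext1 i
    refine Fin.succAboveCases p ?_ (fun i => ?_) i
    · simp [insPerm_self]
    · simp [insPerm_succAbove]
  rw [e]
  have : (-1 : ℂ) ^ (p : ℕ) * (-1 : ℂ) ^ (p : ℕ) = 1 := by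
    rw [← mul_pow]; simp
  linear_combination (-(-1 : ℂ) ^ (j : ℕ) * ((Equiv.Perm.sign σ : ℤ) : ℂ) *
    trProd fun i => W (insPerm p j σ i)) * this

lemma altTr_sub {N n : ℕ} (v : Fin (n + 1) → Matrix (Fin N) (Fin N) ℂ) :
    altTr N n (fun i => v i.succ - v 0) =
      ∑ j : Fin (n + 1), (-1 : ℂ) ^ (j : ℕ) * altTr N n (fun i => v (j.succAbove i)) := by
  have e : (fun i : Fin n => v i.succ - v 0) = (fun i => v i.succ) + (fun _ => - v 0) := by
    ext1 i; simp [sub_eq_add_neg]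
  rw [e, Fin.sum_univ_succ]
  have := (altTr N n).toMultilinearMap.map_add_eq_map_add_linearDeriv_add
    (fun i => v i.succ) (fun _ => - v 0)
  simp only [AlternatingMap.coe_multilinearMap] at this
  rw [this, Finset.sum_eq_zero, add_zero]
  · congr 1
    · simp
    rw [MultilinearMap.linearDeriv_apply]
    refine Finset.sum_congr rfl fun j _ => ?_
    simp only [AlternatingMap.coe_multilinearMap]
    rcases n with _ | n
    · exact j.elim0
    have h1 : Function.update (fun i : Fin (n + 1) => v i.succ) j (-v 0) =
        j.insertNth (α := fun _ => Matrix (Fin N) (Fin N) ℂ) (- v 0)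
          (fun i => v (j.succAbove i).succ) := by
      ext1 i
      refine Fin.succAboveCases j ?_ (fun i => ?_) i
      · simp
      · simp
    have h2 : (fun i => v (j.succ.succAbove i)) =
        Fin.cons (α := fun _ => Matrix (Fin N) (Fin N) ℂ) (v 0)
          (fun i => v (j.succAbove i).succ) := by
      ext1 i
      refine Fin.cases ?_ (fun i => ?_) i
      · simp
      · simp
    rw [h1, h2, AlternatingMap.map_insertNth]
    have h3 := (altTr N (n + 1)).map_update_neg (Fin.cons (α := fun _ => Matrix (Fin N) (Fin N) ℂ)
      (v 0) (fun i => v (j.succAbove i).succ)) 0 (v 0)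
    simp only [Fin.update_cons_zero] at h3
    simp only [Matrix.vecCons]
    rw [h3]
    simp [pow_succ]
  · intro s hs
    obtain ⟨a, ha, b, hb, hab⟩ := Finset.one_lt_card.mp (Finset.mem_filter.mp hs).2
    refine (altTr N n).map_eq_zero_of_eq _ ?_ hab
    simp [ha, hb]

lemma hasDerivAt_prod {N n : ℕ} (A : Matrix (Fin N) (Fin N) ℂ)
    (f : Fin n → ℝ → Matrix (Fin N) (Fin N) ℂ) (x : ℝ)
    (hf : ∀ i, HasDerivAt (f i) (- (A * f i x)) x) :
    HasDerivAt (fun y => (List.ofFn (fun i => f i y)).prod)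
      (- ∑ p : Fin n, (List.ofFn (p.castSucc.insertNth
        (α := fun _ => Matrix (Fin N) (Fin N) ℂ) A (fun i => f i x))).prod) x := by
  induction n with
  | zero => simpa using hasDerivAt_const x (1 : Matrix (Fin N) (Fin N) ℂ)
  | succ n ih =>
    have h := (hf 0).mul (ih (fun i => f i.succ) (fun i => hf i.succ))
    simp only [List.ofFn_succ (n := n), List.prod_cons]
    refine HasDerivAt.congr_deriv h ?_
    rw [Fin.sum_univ_succ]
    have key : ∀ p : Fin n, (List.ofFn (p.succ.castSucc.insertNth
        (α := fun _ => Matrix (Fin N) (Fin N) ℂ) A (fun i => f i x))).prod = f 0 x *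
        (List.ofFn (p.castSucc.insertNth
        (α := fun _ => Matrix (Fin N) (Fin N) ℂ) A (fun i => f i.succ x))).prod := by
      intro p
      rw [List.ofFn_succ, List.prod_cons]
      congr 1
      congr 2
      ext1 i
      rw [← Fin.succ_castSucc]
      refine Fin.succAboveCases p.castSucc ?_ (fun i => ?_) i
      · simp
      · rw [← Fin.succ_succAbove_succ, Fin.insertNth_apply_succAbove,
          Fin.insertNth_apply_succAbove]
    simp only [key]
    rw [← Finset.mul_sum]
    simp [List.ofFn_succ, mul_assoc]
    abel

lemma isCompact_simplexΔ (n : ℕ) : IsCompact (simplexΔ n) := by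
  refine (isCompact_univ_pi (fun _ : Fin n => isCompact_Icc (a := (0:ℝ)) (b := 1))).of_isClosed_subset ?_ ?_
  · have : simplexΔ n = (⋂ i, {t : Fin n → ℝ | 0 ≤ t i}) ∩ {t | ∑ i, t i ≤ 1} := by
      ext t; simp [simplexΔ]
    rw [this]
    refine (isClosed_iInter fun i => isClosed_le (by fun_prop) (by fun_prop)).inter
      (isClosed_le (by fun_prop) (by fun_prop))
  · rintro t ⟨h0, h1⟩ i -
    exact ⟨h0 i, (Finset.single_le_sum (fun j _ => h0 j) (Finset.mem_univ i)).trans h1⟩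

lemma insertNth_mem_simplexΔ {n : ℕ} (j : Fin (n + 1)) (x : ℝ) (s : Fin n → ℝ) :
    j.insertNth (α := fun _ => ℝ) x s ∈ simplexΔ (n + 1) ↔
      s ∈ simplexΔ n ∧ x ∈ Set.Icc 0 (1 - ∑ i, s i) := by
  simp only [simplexΔ, Set.mem_ofPred_eq, Fin.forall_iff_succAbove j, Fin.insertNth_apply_same,
    Fin.insertNth_apply_succAbove, Fin.sum_univ_succAbove _ j, Set.mem_Icc]
  constructor
  · rintro ⟨⟨h1, h2⟩, h3⟩
    exact ⟨⟨h2, by linarith⟩, h1, by linarith⟩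
  · rintro ⟨⟨h1, h2⟩, h3, h4⟩
    exact ⟨⟨h3, h1⟩, by linarith⟩

lemma integral_simplex_succ {n : ℕ} (j : Fin (n + 1)) (g : (Fin (n + 1) → ℝ) → ℂ)
    (hg : IntegrableOn g (simplexΔ (n + 1))) :
    ∫ t in simplexΔ (n + 1), g t = ∫ s in simplexΔ n,
      ∫ x in (0:ℝ)..(1 - ∑ i, s i), g (j.insertNth (α := fun _ => ℝ) x s) := by
  have hm := (isCompact_simplexΔ n).measurableSet
  have hm' := (isCompact_simplexΔ (n + 1)).measurableSet
  have hmp := (volume_preserving_piFinSuccAbove (fun _ : Fin (n + 1) => ℝ) j).symm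
  have hi : Integrable ((simplexΔ (n + 1)).indicator g) := hg.integrable_indicator hm'
  rw [← integral_indicator hm', ← integral_indicator hm,
    ← hmp.integral_comp (MeasurableEquiv.measurableEmbedding _)]
  have hi2 := hmp.integrable_comp_of_integrable hi
  rw [Measure.volume_eq_prod] at hi2 ⊢
  refine (integral_prod_symm _ hi2).trans ?_
  simp only [Function.comp_apply]
  congr 1
  ext1 s
  have e : ∀ x : ℝ, (MeasurableEquiv.piFinSuccAbove (fun _ : Fin (n + 1) => ℝ) j).symm (x, s) =
    j.insertNth (α := fun _ => ℝ) x s := fun x => rfl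
  simp only [e]
  by_cases hs : s ∈ simplexΔ n
  · rw [Set.indicator_of_mem hs, intervalIntegral.integral_of_le (by linarith [hs.2]),
      ← integral_Icc_eq_integral_Ioc, ← integral_indicator measurableSet_Icc]
    congr 1
    ext1 x
    by_cases hx : x ∈ Set.Icc 0 (1 - ∑ i, s i)
    · rw [Set.indicator_of_mem hx, Set.indicator_of_mem]
      exact (insertNth_mem_simplexΔ j x s).2 ⟨hs, hx⟩
    · rw [Set.indicator_of_notMem hx, Set.indicator_of_notMem]
      exact fun h => hx ((insertNth_mem_simplexΔ j x s).1 h).2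
  · rw [Set.indicator_of_notMem hs]
    convert integral_zero ℝ ℂ with x
    rw [Set.indicator_of_notMem]
    exact fun h => hs ((insertNth_mem_simplexΔ j x s).1 h).1

lemma stokes_coord {n : ℕ} (j : Fin (n + 1)) (F F' : (Fin (n + 1) → ℝ) → ℂ)
    (hF' : ContinuousOn F' (simplexΔ (n + 1)))
    (hd : ∀ t ∈ simplexΔ (n + 1),
      HasDerivAt (fun x => F (Function.update t j x)) (F' t) (t j)) :
    ∫ t in simplexΔ (n + 1), F' t = ∫ s in simplexΔ n,
      (F (j.insertNth (α := fun _ => ℝ) (1 - ∑ i, s i) s) -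
        F (j.insertNth (α := fun _ => ℝ) 0 s)) := by
  rw [integral_simplex_succ j _ (hF'.integrableOn_compact (isCompact_simplexΔ _))]
  refine setIntegral_congr_fun (isCompact_simplexΔ n).measurableSet fun s hs => ?_
  have hle : (0:ℝ) ≤ 1 - ∑ i, s i := by linarith [hs.2]
  have hmem : ∀ x ∈ Set.Icc 0 (1 - ∑ i, s i), j.insertNth (α := fun _ => ℝ) x s ∈
    simplexΔ (n + 1) := fun x hx => (insertNth_mem_simplexΔ j x s).2 ⟨hs, hx⟩
  refine intervalIntegral.integral_eq_sub_of_hasDerivAt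
    (f := fun x => F (j.insertNth (α := fun _ => ℝ) x s)) ?_ ?_
  · intro x hx
    rw [Set.uIcc_of_le hle] at hx
    have := hd _ (hmem x hx)
    simpa using this
  · refine ContinuousOn.intervalIntegrable ?_
    rw [Set.uIcc_of_le hle]
    refine hF'.comp (Continuous.continuousOn ?_) hmem
    refine continuous_pi fun i => ?_
    refine Fin.succAboveCases j ?_ (fun i => ?_) i
    · simpa using continuous_id'
    · simpa using continuous_const

lemma integral_simplex_perm {n : ℕ} (j : Fin (n + 1)) (G : (Fin (n + 1) → ℝ) → ℂ) :
    ∫ s in simplexΔ n, G (Fin.cons (α := fun _ => ℝ) (1 - ∑ i, s i) s) =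
      ∫ s in simplexΔ n, G (j.insertNth (α := fun _ => ℝ) (1 - ∑ i, s i) s) := by
  refine Fin.cases ?_ (fun i => ?_) j
  · simp
  rcases n with _ | n
  · exact i.elim0
  have hm := (isCompact_simplexΔ (n + 1)).measurableSet
  have h1 := (volume_preserving_piFinSuccAbove (fun _ : Fin (n + 1) => ℝ) 0)
  have h3 := (volume_preserving_piFinSuccAbove (fun _ : Fin (n + 1) => ℝ) i).symm
  have h2a : MeasurePreserving (fun a : (Fin n → ℝ) × ℝ => (a.1, (1 - ∑ k, a.1 k) - a.2))
      (volume.prod volume) (volume.prod volume) := by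
    refine (MeasurePreserving.id volume).skew_product
      (g := fun (u : Fin n → ℝ) (x : ℝ) => (1 - ∑ k, u k) - x) (by fun_prop) ?_
    filter_upwards with u
    exact (Measure.measurePreserving_sub_left volume _).map_eq
  have h2 : MeasurePreserving (fun a : ℝ × (Fin n → ℝ) => ((1 - ∑ k, a.2 k) - a.1, a.2))
      (volume.prod volume) (volume.prod volume) := by
    exact (Measure.measurePreserving_swap.comp h2a).comp Measure.measurePreserving_swap
  have h := h3.comp (h2.comp h1)
  set φ := ((MeasurableEquiv.piFinSuccAbove (fun _ : Fin (n + 1) => ℝ) i).symm ∘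
    (fun a : ℝ × (Fin n → ℝ) => ((1 - ∑ k, a.2 k) - a.1, a.2)) ∘
    (MeasurableEquiv.piFinSuccAbove (fun _ : Fin (n + 1) => ℝ) 0)) with hφ
  have hφa : ∀ t, φ t = i.insertNth (α := fun _ => ℝ) (1 - ∑ k, t k) (fun k => t k.succ) := by
    intro t
    have : φ t = i.insertNth (α := fun _ => ℝ) ((1 - ∑ k : Fin n, t k.succ) - t 0)
      (fun k => t k.succ) := rfl
    rw [this, Fin.sum_univ_succ]
    congr 1
    ring
  have hsum : ∀ t, 1 - ∑ k, φ t k = t 0 := by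
    intro t
    rw [hφa, Fin.sum_univ_succAbove _ i, Fin.sum_univ_succ t]
    simp
    ring
  have hemb : MeasurableEmbedding φ := by
    refine (MeasurableEquiv.measurableEmbedding _).comp (MeasurableEmbedding.comp ?_
      (MeasurableEquiv.measurableEmbedding _))
    have hmeas : Measurable (fun a : ℝ × (Fin n → ℝ) => ((1 - ∑ k, a.2 k) - a.1, a.2)) := by
      fun_prop
    refine (MeasurableEquiv.mk ⟨_, fun a : ℝ × (Fin n → ℝ) => ((1 - ∑ k, a.2 k) - a.1, a.2),
      fun a => ?_, fun a => ?_⟩ hmeas hmeas).measurableEmbedding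
    · simp
    · simp
  have hpre : φ ⁻¹' (simplexΔ (n + 1)) = simplexΔ (n + 1) := by
    ext t
    rw [Set.mem_preimage, hφa, insertNth_mem_simplexΔ]
    have e : t = (0 : Fin (n + 1)).insertNth (α := fun _ => ℝ) (t 0) (fun k => t k.succ) := by
      simp only [Fin.insertNth_zero']
      exact (Fin.cons_self_tail t).symm
    conv_rhs => rw [e, insertNth_mem_simplexΔ]
    rw [Fin.sum_univ_succ t]
    simp only [Set.mem_Icc]
    refine and_congr_right fun _ => ?_
    constructor <;> rintro ⟨h1, h2⟩ <;> constructor <;> linarith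
  rw [← h.setIntegral_preimage_emb hemb, hpre]
  refine setIntegral_congr_fun hm fun t _ => ?_
  rw [hsum, hφa]
  congr 1
  ext1 k
  refine Fin.cases ?_ (fun k => ?_) k
  · have : (0 : Fin (n + 2)) = i.succ.succAbove 0 := by simp
    conv_rhs => rw [this, Fin.insertNth_apply_succAbove]
    simp
  · simp only [Fin.cons_succ]
    refine Fin.succAboveCases i ?_ (fun k => ?_) k
    · simp
    · rw [← Fin.succ_succAbove_succ, Fin.insertNth_apply_succAbove,
        Fin.insertNth_apply_succAbove]

lemma simplexComb_eq {n N : ℕ} (U : Fin (n + 1) → Matrix (Fin N) (Fin N) ℂ) (t : Fin n → ℝ) :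
    simplexComb U t = U 0 + ∑ i : Fin n, ((t i : ℝ) : ℂ) • (U i.succ - U 0) := by
  simp only [simplexComb, smul_sub, Finset.sum_sub_distrib, ← Finset.sum_smul]
  push_cast
  rw [sub_smul, one_smul]
  abel

lemma continuous_simplexComb {n N : ℕ} (U : Fin (n + 1) → Matrix (Fin N) (Fin N) ℂ) :
    Continuous (simplexComb U) := by
  unfold simplexComb
  fun_prop

lemma isUnit_simplexComb {n N : ℕ} (U : Fin (n + 2) → Matrix (Fin N) (Fin N) ℂ)
    (hU : ∀ j, U j ∈ Matrix.unitaryGroup (Fin N) ℂ)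
    (hclose : ∀ k l, ‖U k - U l‖ < 1) (t : Fin (n + 1) → ℝ) (ht : t ∈ simplexΔ (n + 1)) :
    IsUnit (simplexComb U t) := by
  obtain ⟨i₀, hi₀⟩ := Finite.exists_max (fun i : Fin (n + 1) => ‖U i.succ - U 0‖)
  set E := ∑ i : Fin (n + 1), ((t i : ℝ) : ℂ) • (U i.succ - U 0) with hE
  have hEn : ‖E‖ < 1 := by
    calc ‖E‖ ≤ ∑ i : Fin (n + 1), ‖((t i : ℝ) : ℂ) • (U i.succ - U 0)‖ := norm_sum_le _ _
      _ ≤ ∑ i : Fin (n + 1), t i * ‖U i₀.succ - U 0‖ := by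
          refine Finset.sum_le_sum fun i _ => ?_
          rw [norm_smul, Complex.norm_real, Real.norm_of_nonneg (ht.1 i)]
          exact mul_le_mul_of_nonneg_left (hi₀ i) (ht.1 i)
      _ = (∑ i, t i) * ‖U i₀.succ - U 0‖ := by rw [Finset.sum_mul]
      _ ≤ 1 * ‖U i₀.succ - U 0‖ := mul_le_mul_of_nonneg_right ht.2 (norm_nonneg _)
      _ < 1 := by rw [one_mul]; exact hclose _ _
  have hs : star (U 0) ∈ unitary (Matrix (Fin N) (Fin N) ℂ) := Unitary.star_mem (hU 0)
  have h1 : IsUnit (1 - (-(star (U 0) * E))) := by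
    apply isUnit_one_sub_of_norm_lt_one
    rw [norm_neg, CStarRing.norm_mem_unitary_mul _ hs]
    exact hEn
  have h2 : U 0 * star (U 0) = 1 := (Matrix.mem_unitaryGroup_iff).1 (hU 0)
  have h2' : star (U 0) * U 0 = 1 := (Matrix.mem_unitaryGroup_iff').1 (hU 0)
  have h3 : IsUnit (U 0) := ⟨⟨U 0, star (U 0), h2, h2'⟩, rfl⟩
  have h4 : simplexComb U t = U 0 * (1 - (-(star (U 0) * E))) := by
    rw [simplexComb_eq, sub_neg_eq_add, mul_add, mul_one, ← mul_assoc, h2, one_mul]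
  rw [h4]
  exact h3.mul h1

lemma continuous_trProd {N n : ℕ} :
    Continuous (trProd : (Fin n → Matrix (Fin N) (Fin N) ℂ) → ℂ) := by
  unfold trProd
  refine Continuous.matrix_trace ?_
  simp only [List.ofFn_eq_map]
  exact continuous_list_prod _ fun i _ => continuous_apply i

/-- the pulled back Maurer-Cartan form, in coordinates -/
noncomputable def mcW {n N : ℕ} (U : Fin (n + 2) → Matrix (Fin N) (Fin N) ℂ)
    (t : Fin (n + 1) → ℝ) (k : Fin (n + 1)) : Matrix (Fin N) (Fin N) ℂ :=
  (simplexComb U t)⁻¹ * (U k.succ - U 0)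

lemma continuousOn_mcW {n N : ℕ} (U : Fin (n + 2) → Matrix (Fin N) (Fin N) ℂ)
    (hV : ∀ t ∈ simplexΔ (n + 1), IsUnit (simplexComb U t)) (k : Fin (n + 1)) :
    ContinuousOn (fun t => mcW U t k) (simplexΔ (n + 1)) := by
  unfold mcW
  refine ContinuousOn.mul ?_ continuousOn_const
  intro t ht
  obtain ⟨u, hu⟩ := hV t ht
  have h := NormedRing.inverse_continuousAt u
  rw [hu] at h
  simp only [Matrix.nonsing_inv_eq_ringInverse]
  exact (ContinuousAt.comp (f := simplexComb U) h
    (continuous_simplexComb U).continuousAt).continuousWithinAt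

lemma hasDerivAt_mcW {n N : ℕ} (U : Fin (n + 2) → Matrix (Fin N) (Fin N) ℂ)
    (t : Fin (n + 1) → ℝ) (ht : IsUnit (simplexComb U t)) (j k : Fin (n + 1)) :
    HasDerivAt (fun x => mcW U (Function.update t j x) k) (-(mcW U t j * mcW U t k)) (t j) := by
  have h1 : HasDerivAt (fun x => simplexComb U (Function.update t j x)) (U j.succ - U 0) (t j) := by
    have e : (fun x => simplexComb U (Function.update t j x)) =
        fun x : ℝ => (simplexComb U t - ((t j : ℝ) : ℂ) • (U j.succ - U 0)) +
          x • (U j.succ - U 0) := by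
      ext1 x
      rw [simplexComb_eq, simplexComb_eq, Fin.sum_univ_succAbove _ j, Fin.sum_univ_succAbove _ j]
      simp only [Function.update_self, ne_eq, Fin.succAbove_ne, not_false_eq_true,
        Function.update_of_ne]
      have : x • (U j.succ - U 0) = ((x : ℝ) : ℂ) • (U j.succ - U 0) :=
        (Complex.coe_smul x _).symm
      rw [this]
      abel
    rw [e]
    simpa using ((hasDerivAt_id (t j)).smul_const (U j.succ - U 0)).const_add
      (simplexComb U t - ((t j : ℝ) : ℂ) • (U j.succ - U 0))
  obtain ⟨u, hu⟩ := ht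
  have h2 := hasFDerivAt_ringInverse (𝕜 := ℝ) u
  have hu' : simplexComb U (Function.update t j (t j)) = u := by rw [Function.update_eq_self, hu]
  rw [← hu'] at h2
  have h3 := (h2.comp_hasDerivAt (t j) h1).mul_const (U k.succ - U 0)
  have hinv : ((u⁻¹ : (Matrix (Fin N) (Fin N) ℂ)ˣ) : Matrix (Fin N) (Fin N) ℂ) =
      (simplexComb U t)⁻¹ := by
    rw [← hu, Matrix.coe_units_inv]
  unfold mcW
  simp only [Matrix.nonsing_inv_eq_ringInverse] at hinv ⊢
  refine HasDerivAt.congr_deriv h3 ?_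
  simp [hinv, mul_assoc]

/-- coefficient functions -/
noncomputable def cF {n N : ℕ} (U : Fin (n + 2) → Matrix (Fin N) (Fin N) ℂ)
    (j : Fin (n + 1)) (t : Fin (n + 1) → ℝ) : ℂ :=
  altTr N n (fun i => mcW U t (j.succAbove i))

/-- their derivatives -/
noncomputable def cF' {n N : ℕ} (U : Fin (n + 2) → Matrix (Fin N) (Fin N) ℂ)
    (j : Fin (n + 1)) (t : Fin (n + 1) → ℝ) : ℂ :=
  ∑ σ : Equiv.Perm (Fin n), ((Equiv.Perm.sign σ : ℤ) : ℂ) * (- ∑ p : Fin n,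
    trProd (p.castSucc.insertNth (α := fun _ => Matrix (Fin N) (Fin N) ℂ) (mcW U t j)
          (fun i => mcW U t (j.succAbove (σ i)))))

lemma sum_cF' {n N : ℕ} (hn : Odd n) (U : Fin (n + 2) → Matrix (Fin N) (Fin N) ℂ)
    (t : Fin (n + 1) → ℝ) :
    ∑ j : Fin (n + 1), (-1 : ℂ) ^ (j : ℕ) * cF' U j t = 0 := by
  have h : ∀ p : Fin n, _ := fun p => sum_insert_eq_zero hn (mcW U t) p.castSucc
  have h2 := Finset.sum_eq_zero (s := Finset.univ) fun p _ => h p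
  rw [Finset.sum_comm] at h2
  rw [← neg_eq_zero, ← h2, ← Finset.sum_neg_distrib]
  refine Finset.sum_congr rfl fun j _ => ?_
  rw [← Finset.mul_sum, Finset.sum_comm, cF', ← mul_neg, ← Finset.sum_neg_distrib]
  congr 1
  refine Finset.sum_congr rfl fun σ _ => ?_
  rw [← Finset.mul_sum]
  ring

lemma continuousOn_cF {n N : ℕ} (U : Fin (n + 2) → Matrix (Fin N) (Fin N) ℂ)
    (hV : ∀ t ∈ simplexΔ (n + 1), IsUnit (simplexComb U t)) (j : Fin (n + 1)) :
    ContinuousOn (cF U j) (simplexΔ (n + 1)) := by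
  unfold cF
  simp only [altTr_apply]
  refine continuousOn_finsetSum _ fun σ _ => continuousOn_const.mul ?_
  exact continuous_trProd.comp_continuousOn (continuousOn_pi.2 fun i => continuousOn_mcW U hV _)

lemma continuousOn_cF' {n N : ℕ} (U : Fin (n + 2) → Matrix (Fin N) (Fin N) ℂ)
    (hV : ∀ t ∈ simplexΔ (n + 1), IsUnit (simplexComb U t)) (j : Fin (n + 1)) :
    ContinuousOn (cF' U j) (simplexΔ (n + 1)) := by
  unfold cF'
  refine continuousOn_finsetSum _ fun σ _ => continuousOn_const.mul ?_
  refine ContinuousOn.neg (continuousOn_finsetSum _ fun p _ => ?_)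
  refine continuous_trProd.comp_continuousOn ?_
  exact (continuousOn_mcW U hV j).finInsertNth _
    (continuousOn_pi.2 fun i => continuousOn_mcW U hV _)

lemma hasDerivAt_cF {n N : ℕ} (U : Fin (n + 2) → Matrix (Fin N) (Fin N) ℂ)
    (t : Fin (n + 1) → ℝ) (ht : IsUnit (simplexComb U t)) (j : Fin (n + 1)) :
    HasDerivAt (fun x => cF U j (Function.update t j x)) (cF' U j t) (t j) := by
  unfold cF cF'
  simp only [altTr_apply]
  refine HasDerivAt.fun_sum fun σ _ => HasDerivAt.const_mul _ ?_
  have h := hasDerivAt_prod (mcW U t j)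
    (fun i x => mcW U (Function.update t j x) (j.succAbove (σ i))) (t j) (fun i => by
      have := hasDerivAt_mcW U t ht j (j.succAbove (σ i))
      simpa using this)
  have h2 := (LinearMap.toContinuousLinearMap
    ((Matrix.traceLinearMap (Fin N) ℂ ℂ).restrictScalars ℝ)).hasFDerivAt.comp_hasDerivAt (t j) h
  unfold trProd
  refine HasDerivAt.congr_deriv h2 ?_
  simp

lemma chOdd_eq {n N : ℕ} (U : Fin (n + 1) → Matrix (Fin N) (Fin N) ℂ) :
    chOdd n N U = oddChernConst n * ∫ t in simplexΔ n,
      altTr N n (fun i => (simplexComb U t)⁻¹ * (U i.succ - U 0)) := by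
  simp only [chOdd, altTr_apply, trProd, List.ofFn_eq_map]

lemma face_succ {n N : ℕ} (U : Fin (n + 2) → Matrix (Fin N) (Fin N) ℂ) (j : Fin (n + 1)) :
    chOdd n N (fun i => U (j.succ.succAbove i)) = oddChernConst n * ∫ s in simplexΔ n,
      cF U j (j.insertNth (α := fun _ => ℝ) 0 s) := by
  rw [chOdd_eq]
  congr 2
  ext1 s
  unfold cF mcW
  have e : simplexComb (fun i => U (j.succ.succAbove i)) s =
      simplexComb U (j.insertNth (α := fun _ => ℝ) 0 s) := by
    rw [simplexComb_eq, simplexComb_eq, Fin.sum_univ_succAbove _ j]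
    simp
  rw [e]
  simp

lemma face_zero {n N : ℕ} (U : Fin (n + 2) → Matrix (Fin N) (Fin N) ℂ) :
    chOdd n N (fun i => U ((0 : Fin (n + 2)).succAbove i)) =
    oddChernConst n * ∫ s in simplexΔ n, ∑ j : Fin (n + 1), (-1 : ℂ) ^ (j : ℕ) *
      cF U j (Fin.cons (α := fun _ => ℝ) (1 - ∑ i, s i) s) := by
  rw [chOdd_eq]
  congr 2
  ext1 s
  have e : simplexComb (fun i => U ((0 : Fin (n + 2)).succAbove i)) s =
      simplexComb U (Fin.cons (α := fun _ => ℝ) (1 - ∑ i, s i) s) := by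
    simp only [simplexComb]
    rw [Fin.sum_univ_succ (n := n), Fin.sum_univ_succ (n := n)]
    simp
  unfold cF
  rw [e, ← altTr_sub]
  congr 1
  ext1 i
  simp [mcW, ← mul_sub]

/-- for `n` odd, the Alexander–Spanier coboundary of `Chⁿ` vanishes on
`n+2` pairwise close unitaries. -/
theorem chOdd_coboundary_eq_zero
    (N n : ℕ) (hn : Odd n)
    (U : Fin (n + 2) → Matrix (Fin N) (Fin N) ℂ)
    (hU : ∀ j, U j ∈ Matrix.unitaryGroup (Fin N) ℂ)
    (hclose : ∀ k l, ‖U k - U l‖ < 1) :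
    ∑ j : Fin (n + 2), ((-1 : ℂ) ^ (j : ℕ)) * chOdd n N (fun i => U (j.succAbove i)) = 0 := by
  have hV := isUnit_simplexComb U hU hclose
  have hcomp := isCompact_simplexΔ n
  have hcont : ∀ j : Fin (n + 1), Continuous fun s : Fin n → ℝ =>
      j.insertNth (α := fun _ => ℝ) (1 - ∑ i, s i) s := fun j =>
    Continuous.finInsertNth j (by fun_prop) continuous_id
  have hcont0 : ∀ j : Fin (n + 1), Continuous fun s : Fin n → ℝ =>
      j.insertNth (α := fun _ => ℝ) (0 : ℝ) s := fun j =>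
    Continuous.finInsertNth j (by fun_prop) continuous_id
  have hm1 : ∀ j : Fin (n + 1), ∀ s ∈ simplexΔ n,
      j.insertNth (α := fun _ => ℝ) (1 - ∑ i, s i) s ∈ simplexΔ (n + 1) := fun j s hs =>
    (insertNth_mem_simplexΔ j _ s).2 ⟨hs, by linarith [hs.2], le_rfl⟩
  have hm0 : ∀ j : Fin (n + 1), ∀ s ∈ simplexΔ n,
      j.insertNth (α := fun _ => ℝ) (0 : ℝ) s ∈ simplexΔ (n + 1) := fun j s hs =>
    (insertNth_mem_simplexΔ j _ s).2 ⟨hs, le_rfl, by linarith [hs.2]⟩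
  have hi1 : ∀ j k : Fin (n + 1), IntegrableOn (fun s => cF U j
      (k.insertNth (α := fun _ => ℝ) (1 - ∑ i, s i) s)) (simplexΔ n) := fun j k =>
    ((continuousOn_cF U hV j).comp (hcont k).continuousOn (hm1 k)).integrableOn_compact hcomp
  have hi0 : ∀ j : Fin (n + 1), IntegrableOn (fun s => cF U j
      (j.insertNth (α := fun _ => ℝ) (0 : ℝ) s)) (simplexΔ n) := fun j =>
    ((continuousOn_cF U hV j).comp (hcont0 j).continuousOn (hm0 j)).integrableOn_compact hcomp
  have hst : ∑ j : Fin (n + 1), (-1 : ℂ) ^ (j : ℕ) *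
      ∫ t in simplexΔ (n + 1), cF' U j t = 0 := by
    simp only [← integral_const_mul]
    rw [← integral_finsetSum]
    · simp [sum_cF' hn]
    · intro j _
      exact ((continuousOn_cF' U hV j).integrableOn_compact (isCompact_simplexΔ _)).const_mul _
  have hj : ∀ j : Fin (n + 1), ∫ t in simplexΔ (n + 1), cF' U j t =
      (∫ s in simplexΔ n, cF U j (Fin.cons (α := fun _ => ℝ) (1 - ∑ i, s i) s)) -
      ∫ s in simplexΔ n, cF U j (j.insertNth (α := fun _ => ℝ) 0 s) := by
    intro j
    rw [stokes_coord j (cF U j) (cF' U j) (continuousOn_cF' U hV j)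
      (fun t ht => hasDerivAt_cF U t (hV t ht) j), integral_sub (hi1 j j) (hi0 j),
      integral_simplex_perm j]
  rw [Fin.sum_univ_succ, face_zero, integral_finsetSum]
  · simp only [face_succ, integral_const_mul]
    simp only [hj, mul_sub, Finset.sum_sub_distrib] at hst
    rw [sub_eq_zero] at hst
    rw [hst, Finset.mul_sum, Fin.val_zero, pow_zero, one_mul, ← Finset.sum_add_distrib]
    refine Finset.sum_eq_zero fun j _ => ?_
    rw [Fin.val_succ]
    ring
  · intro j _
    refine Integrable.const_mul ?_ _
    simpa [IntegrableOn] using hi1 j 0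
end

section
/- Let n be odd and for j = 0, …, n let Uⱼ : [0,1] → M_N(ℂ) be continuously differentiable paths of unitary matrices such that ‖Uₖ(τ) − Uₗ(τ)‖ < 1 for all k, l and all τ ∈ [0,1]. Then Chⁿ(U₀(1),…,Uₙ(1)) − Chⁿ(U₀(0),…,Uₙ(0)) = Σ_{j=0}^{n} (−1)ʲ ∫₀¹ T_τ(U₀(τ), …, Û_j(τ), …, Uₙ(τ)) dτ, where for unitary paths W₀(τ),…,W_{n−1}(τ) one sets W(t,τ) = Σⱼ₌₀^{n−1} tⱼWⱼ(τ) on Δ^{n−1} and T_τ(W₀,…,W_{n−1}) = n·cₙ ∫_{Δ^{n−1}} Σ_{σ∈S_{n−1}} sgn(σ) tr( W(t,τ)⁻¹ (∂W/∂τ)(t,τ) · W(t,τ)⁻¹(W_{σ(1)}(τ)−W₀(τ)) ⋯ W(t,τ)⁻¹(W_{σ(n−1)}(τ)−W₀(τ)) ) dt. In particular the cocycles Chⁿ associated to the two endpoint families differ by an Alexander–Spanier coboundary. -/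
open scoped Matrix.Norms.L2Operator
open MeasureTheory

/-- The transgression cochain `T_τ` associated to a family of `m+1` paths of unitaries:
`T_τ(W₀,…,Wₘ) = (m+1)·c_{m+1} ∫_{Δᵐ} Σ_{σ∈Sₘ} sgn σ ·
  tr( W(t,τ)⁻¹ (∂W/∂τ)(t,τ) · W(t,τ)⁻¹(W_{σ(1)}−W₀) ⋯ W(t,τ)⁻¹(W_{σ(m)}−W₀) ) dt`,
where `W(t,τ) = Σⱼ tⱼ Wⱼ(τ)`. -/
noncomputable def transgression (m N : ℕ)
    (W : Fin (m + 1) → ℝ → Matrix (Fin N) (Fin N) ℂ) (τ : ℝ) : ℂ :=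
  (((m + 1 : ℕ) : ℂ)) * oddChernConst (m + 1) *
    ∫ t in simplexΔ m, ∑ σ : Equiv.Perm (Fin m),
      ((Equiv.Perm.sign σ : ℤ) : ℂ) *
        Matrix.trace
          ((simplexComb (fun j => W j τ) t)⁻¹ *
            derivWithin (fun s => simplexComb (fun j => W j s) t) (Set.Icc 0 1) τ *
            (((List.finRange m).map fun i =>
              (simplexComb (fun j => W j τ) t)⁻¹ * (W (σ i).succ τ - W 0 τ)).prod))

namespace ChTrans

/-- The ordered product of a finite family. -/
def wp {R : Type*} [Monoid R] {m : ℕ} (f : Fin m → R) : R := ((List.finRange m).map f).prod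

lemma wp_succ {R : Type*} [Monoid R] {m : ℕ} (f : Fin (m + 1) → R) :
    wp f = f 0 * wp (fun j => f j.succ) := by
  simp [wp, List.finRange_succ, Function.comp_def]

lemma wp_last {R : Type*} [Monoid R] {m : ℕ} (f : Fin (m + 1) → R) :
    wp f = wp (fun j : Fin m => f j.castSucc) * f (Fin.last m) := by
  simp [wp, List.finRange_succ_last, Function.comp_def]

lemma wp_update_mul {R : Type*} [Monoid R] : ∀ {m : ℕ} (t : Fin m → R) (k : Fin m) (x : R),
    wp (Function.update t k (x * t k)) = wp (k.castSucc.insertNth x t : Fin (m + 1) → R) := by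
  intro m
  induction m with
  | zero => intro t k; exact k.elim0
  | succ m ih =>
    intro t k x
    refine Fin.cases ?_ (fun k => ?_) k
    · rw [wp_succ, wp_succ, wp_succ]
      simp [mul_assoc]
    · rw [wp_succ, wp_succ]
      have h1 : (fun j : Fin m => Function.update t k.succ (x * t k.succ) j.succ)
          = Function.update (fun j : Fin m => t j.succ) k (x * t k.succ) := by
        funext j
        by_cases h : j = k
        · subst h; simp
        · simp [h]
      rw [h1, ih (fun j => t j.succ) k x]
      have h2 : (k.succ.castSucc.insertNth x t : Fin (m + 2) → R) 0 = t 0 := by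
        rw [Fin.castSucc_succ] 
        rw [← Fin.succ_succAbove_zero k.castSucc, Fin.insertNth_apply_succAbove]
      rw [h2]
      have h3 : Function.update t k.succ (x * t k.succ) 0 = t 0 := by
        rw [Function.update_of_ne (Fin.succ_ne_zero k).symm]
      rw [h3]
      have h4 : (k.castSucc.insertNth x (fun j => t j.succ) : Fin (m + 1) → R) =
          fun j => (k.succ.castSucc.insertNth x t : Fin (m + 2) → R) j.succ := by
        funext j
        refine Fin.succAboveCases k.castSucc ?_ (fun i => ?_) j
        · simp [Fin.castSucc_succ]
        · rw [Fin.insertNth_apply_succAbove, Fin.castSucc_succ, ← Fin.succ_succAbove_succ,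
            Fin.insertNth_apply_succAbove]
      rw [h4]

lemma wp_eq {m : ℕ} {N : ℕ} (f : Fin m → Matrix (Fin N) (Fin N) ℂ) :
    wp f = MultilinearMap.mkPiAlgebraFin ℂ m (Matrix (Fin N) (Fin N) ℂ) f := by
  rw [MultilinearMap.mkPiAlgebraFin_apply, List.ofFn_eq_map, wp]

lemma sum_perm_succ {m : ℕ} (F : (Fin (m + 1) → Fin (m + 1)) → ℂ) :
    ∑ σ : Equiv.Perm (Fin (m + 1)), ((Equiv.Perm.sign σ : ℤ) : ℂ) * F σ =
      ∑ i : Fin (m + 1), (-1 : ℂ) ^ (i : ℕ) * ∑ σ : Equiv.Perm (Fin m),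
        ((Equiv.Perm.sign σ : ℤ) : ℂ) * F (Fin.cons i (i.succAbove ∘ σ)) := by
  simp_rw [Finset.mul_sum]
  rw [← Fintype.sum_prod_type']
  let e : Fin (m + 1) × Equiv.Perm (Fin m) → Equiv.Perm (Fin (m + 1)) := fun p =>
    p.1.cycleRange.symm * Equiv.Perm.decomposeFin.symm (0, p.2)
  have e0 : ∀ p, e p 0 = p.1 := by intro p; simp [e]
  have es : ∀ p j, e p (Fin.succ j) = p.1.succAbove (p.2 j) := by intro p j; simp [e]
  have inj : Function.Injective e := by
    rintro ⟨i, σ⟩ ⟨j, σ'⟩ h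
    have h0 : i = j := by
      have := e0 (i, σ)
      rw [h, e0] at this
      exact this.symm
    subst h0
    congr 1
    ext k
    have := es (i, σ) k
    rw [h, es] at this
    exact congrArg _ (Fin.succAbove_right_injective this).symm
  have bij : Function.Bijective e := by
    rw [Fintype.bijective_iff_injective_and_card]
    refine ⟨inj, ?_⟩
    simp [Fintype.card_perm, Nat.factorial_succ]
  symm
  refine Fintype.sum_bijective e bij _ _ ?_
  rintro ⟨i, σ⟩
  have hs : Equiv.Perm.sign (e (i, σ)) = (-1) ^ (i : ℕ) * Equiv.Perm.sign σ := by
    simp only [e, Equiv.Perm.sign_mul, Equiv.Perm.decomposeFin.symm_sign]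
    rw [Equiv.Perm.sign_symm, Fin.sign_cycleRange]
    simp
  have hf : (Fin.cons i (i.succAbove ∘ σ) : Fin (m + 1) → Fin (m + 1)) = e (i, σ) := by
    funext k
    refine Fin.cases ?_ (fun k => ?_) k
    · simp [e0]
    · simp [es]
  rw [hf, hs]
  push_cast
  ring

lemma sum_perm_mul_right {m : ℕ} (ρ : Equiv.Perm (Fin m)) (F : Equiv.Perm (Fin m) → ℂ) :
    ∑ σ : Equiv.Perm (Fin m), ((Equiv.Perm.sign σ : ℤ) : ℂ) * F (σ * ρ) =
      ((Equiv.Perm.sign ρ : ℤ) : ℂ) *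
        ∑ σ : Equiv.Perm (Fin m), ((Equiv.Perm.sign σ : ℤ) : ℂ) * F σ := by
  rw [Finset.mul_sum]
  refine Fintype.sum_bijective (fun σ => σ * ρ) (Group.mulRight_bijective ρ) _ _ ?_
  intro σ
  have : ((Equiv.Perm.sign ρ : ℤ) : ℂ) * ((Equiv.Perm.sign ρ : ℤ) : ℂ) = 1 := by
    rw [← Int.cast_mul, Int.units_coe_mul_self]; simp
  rw [Equiv.Perm.sign_mul]
  push_cast
  linear_combination (-(((Equiv.Perm.sign σ : ℤ) : ℂ) * F (σ * ρ))) * this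

variable {N : ℕ}

/-- `Σ_σ sgn σ tr (b a_{σ 1} ⋯ a_{σ m})`. -/
noncomputable def altTr {m : ℕ} (b : Matrix (Fin N) (Fin N) ℂ)
    (a : Fin m → Matrix (Fin N) (Fin N) ℂ) : ℂ :=
  ∑ σ : Equiv.Perm (Fin m), ((Equiv.Perm.sign σ : ℤ) : ℂ) *
    Matrix.trace (b * wp (fun i => a (σ i)))

/-- The derivative of `altTr b a` in the second variable. -/
noncomputable def altTr2 {m : ℕ} (b : Matrix (Fin N) (Fin N) ℂ)
    (a a' : Fin m → Matrix (Fin N) (Fin N) ℂ) : ℂ :=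
  ∑ σ : Equiv.Perm (Fin m), ((Equiv.Perm.sign σ : ℤ) : ℂ) *
    Matrix.trace (b * ∑ k, wp (Function.update (fun i => a (σ i)) k (a' (σ k))))

lemma trace_wp_rotate {m : ℕ} (f : Fin (m + 1) → Matrix (Fin N) (Fin N) ℂ) :
    Matrix.trace (wp (fun j => f (finRotate _ j))) = Matrix.trace (wp f) := by
  rw [wp_last, wp_succ f, Matrix.trace_mul_comm]
  simp

lemma sum_update_cyclic {m : ℕ} (hm : Even m) (a y : Fin (m + 1) → Matrix (Fin N) (Fin N) ℂ)
    (k : Fin (m + 1)) :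
    ∑ σ : Equiv.Perm (Fin (m + 1)), ((Equiv.Perm.sign σ : ℤ) : ℂ) *
      Matrix.trace (wp (Function.update (fun i => a (σ i)) k (y (σ k)))) =
    ∑ σ : Equiv.Perm (Fin (m + 1)), ((Equiv.Perm.sign σ : ℤ) : ℂ) *
      Matrix.trace (y (σ 0) * wp (fun j : Fin m => a (σ j.succ))) := by
  refine Fin.induction ?_ (fun k ih => ?_) k
  · refine Finset.sum_congr rfl fun σ _ => ?_
    rw [wp_succ]
    simp
  · rw [← ih]
    have := sum_perm_mul_right (finRotate (m + 1)) (fun σ =>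
      Matrix.trace (wp (Function.update (fun i => a (σ i)) k.castSucc (y (σ k.castSucc)))))
    rw [sign_finRotate] at this
    simp only [Nat.add_sub_cancel, hm.neg_one_pow, Units.val_one, Int.cast_one, one_mul] at this
    rw [← this]
    refine Finset.sum_congr rfl fun σ _ => ?_
    rw [← trace_wp_rotate]
    congr 3
    funext j
    by_cases h : j = k.castSucc
    · subst h; simp
    · have h2 : finRotate (m + 1) j ≠ k.succ := by
        intro h3
        apply h
        apply (finRotate (m + 1)).injective
        rw [h3]; simp
      rw [Function.update_of_ne h2, Function.update_of_ne h]
      rfl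

lemma sum_insert {m : ℕ} (b : Matrix (Fin N) (Fin N) ℂ)
    (a : Fin (m + 1) → Matrix (Fin N) (Fin N) ℂ) (k : Fin m) :
    ∑ σ : Equiv.Perm (Fin (m + 1)), ((Equiv.Perm.sign σ : ℤ) : ℂ) *
      Matrix.trace (b * wp (Function.update (fun i : Fin m => a (σ i.succ)) k
        (a (σ 0) * a (σ k.succ)))) = (-1) ^ (k : ℕ) * altTr b a := by
  have := sum_perm_mul_right (Fin.cycleRange k.castSucc) (fun σ =>
      Matrix.trace (b * wp (fun i => a (σ i))))
  rw [Fin.sign_cycleRange] at this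
  unfold altTr
  push_cast at this
  rw [Fin.val_castSucc] at this
  rw [← this]
  refine Finset.sum_congr rfl fun σ _ => ?_
  rw [wp_update_mul (fun i : Fin m => a (σ i.succ)) k (a (σ 0)), ← Fin.cons_comp_cycleRange]
  congr 4
  funext j
  simp only [Function.comp_apply]
  generalize (Fin.cycleRange k.castSucc) j = l
  refine Fin.cases ?_ (fun l => ?_) l <;> simp

lemma altTr_cyclic {m : ℕ} (hm : Even m) (b : Matrix (Fin N) (Fin N) ℂ)
    (a : Fin (m + 1) → Matrix (Fin N) (Fin N) ℂ) :
    ∑ σ : Equiv.Perm (Fin (m + 1)), ((Equiv.Perm.sign σ : ℤ) : ℂ) *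
      Matrix.trace (a (σ 0) * b * wp (fun j : Fin m => a (σ j.succ))) = altTr b a := by
  have := sum_perm_mul_right (finRotate (m + 1)) (fun σ =>
      Matrix.trace (b * wp (fun i => a (σ i))))
  rw [sign_finRotate] at this
  simp only [Nat.add_sub_cancel, hm.neg_one_pow, Units.val_one, Int.cast_one, one_mul] at this
  unfold altTr
  rw [← this]
  refine Finset.sum_congr rfl fun σ _ => ?_
  rw [wp_last, mul_assoc, Matrix.trace_mul_comm, mul_assoc]
  simp

/-- The algebraic form of closedness of `tr (V⁻¹ dV)^n`. -/
lemma key_alg {m : ℕ} (hm : Even m) (b : Matrix (Fin N) (Fin N) ℂ)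
    (a d : Fin (m + 1) → Matrix (Fin N) (Fin N) ℂ) :
    altTr2 1 a (fun i => d i - b * a i) = ((m + 1 : ℕ) : ℂ) *
      ∑ i : Fin (m + 1), (-1 : ℂ) ^ (i : ℕ) *
        (altTr (d i - a i * b) (fun k => a (i.succAbove k)) +
          altTr2 b (fun k => a (i.succAbove k)) (fun k => -(a i * a (i.succAbove k)))) := by
  have hL : altTr2 1 a (fun i => d i - b * a i) = ((m + 1 : ℕ) : ℂ) *
      ∑ σ : Equiv.Perm (Fin (m + 1)), ((Equiv.Perm.sign σ : ℤ) : ℂ) *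
      Matrix.trace ((d (σ 0) - b * a (σ 0)) * wp (fun j : Fin m => a (σ j.succ))) := by
    unfold altTr2
    simp_rw [one_mul, Matrix.trace_sum, Finset.mul_sum]
    rw [Finset.sum_comm]
    rw [Finset.sum_congr rfl fun k _ => sum_update_cyclic hm a (fun i => d i - b * a i) k]
    rw [Finset.sum_const, nsmul_eq_mul, Finset.mul_sum]
    simp
  rw [hL]
  congr 1
  have hR := sum_perm_succ (m := m) (fun s =>
    Matrix.trace ((d (s 0) - a (s 0) * b) * wp (fun j : Fin m => a (s j.succ))) +
    Matrix.trace (b * ∑ k, wp (Function.update (fun i : Fin m => a (s i.succ)) k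
        (-(a (s 0) * a (s k.succ))))))
  have hR' : ∑ i : Fin (m + 1), (-1 : ℂ) ^ (i : ℕ) *
        (altTr (d i - a i * b) (fun k => a (i.succAbove k)) +
          altTr2 b (fun k => a (i.succAbove k)) (fun k => -(a i * a (i.succAbove k)))) = _ :=
    Eq.trans (by
      refine Finset.sum_congr rfl fun i _ => ?_
      rw [altTr, altTr2, ← Finset.sum_add_distrib]
      congr 1
      refine Finset.sum_congr rfl fun σ _ => ?_
      simp only [Fin.cons_zero, Fin.cons_succ, Function.comp_apply]
      rw [mul_add]) hR.symm
  rw [hR']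
  simp_rw [mul_add]
  rw [Finset.sum_add_distrib]
  have hz : ∑ σ : Equiv.Perm (Fin (m + 1)), ((Equiv.Perm.sign σ : ℤ) : ℂ) *
      Matrix.trace (b * ∑ k, wp (Function.update (fun i : Fin m => a (σ i.succ)) k
        (-(a (σ 0) * a (σ k.succ))))) = 0 := by
    have hneg : ∀ (f : Fin m → Matrix (Fin N) (Fin N) ℂ) (k : Fin m) (x),
        wp (Function.update f k (-x)) = - wp (Function.update f k x) := by
      intro f k x
      rw [wp_eq, wp_eq]
      exact MultilinearMap.map_update_neg _ f k x
    simp_rw [hneg, Finset.mul_sum, Matrix.trace_sum, Finset.mul_sum]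
    rw [Finset.sum_comm]
    simp_rw [mul_neg, Matrix.trace_neg, mul_neg, Finset.sum_neg_distrib]
    rw [Finset.sum_congr rfl fun k _ => sum_insert b a k]
    rw [← Finset.sum_mul, Fin.sum_neg_one_pow]
    simp [hm]
  rw [hz, add_zero]
  simp_rw [sub_mul, Matrix.trace_sub, mul_sub, Finset.sum_sub_distrib]
  have hl : ∑ σ : Equiv.Perm (Fin (m + 1)), ((Equiv.Perm.sign σ : ℤ) : ℂ) *
      Matrix.trace (b * a (σ 0) * wp (fun j : Fin m => a (σ j.succ))) = altTr b a := by
    unfold altTr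
    refine Finset.sum_congr rfl fun σ _ => ?_
    rw [wp_succ, mul_assoc]
  rw [altTr_cyclic hm b a, hl]

end ChTrans

namespace ChTrans

variable {N : ℕ}

/-- `altTr b` as an alternating map. -/
noncomputable def altAM (m : ℕ) (b : Matrix (Fin N) (Fin N) ℂ) :
    (Matrix (Fin N) (Fin N) ℂ) [⋀^Fin m]→ₗ[ℂ] ℂ :=
  MultilinearMap.alternatization
    (((Matrix.traceLinearMap (Fin N) ℂ ℂ).comp (LinearMap.mulLeft ℂ b)).compMultilinearMap
      (MultilinearMap.mkPiAlgebraFin ℂ m (Matrix (Fin N) (Fin N) ℂ)))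

lemma altAM_apply {m : ℕ} (b : Matrix (Fin N) (Fin N) ℂ)
    (a : Fin m → Matrix (Fin N) (Fin N) ℂ) : altAM m b a = altTr b a := by
  unfold altAM altTr
  rw [MultilinearMap.alternatization_apply]
  refine Finset.sum_congr rfl fun σ _ => ?_
  rw [wp_eq, Units.smul_def, zsmul_eq_mul]
  rfl

lemma alt_update {M : Type*} [AddCommGroup M] [Module ℂ M] {m : ℕ} (f : M [⋀^Fin m]→ₗ[ℂ] ℂ)
    (w : Fin m → M) (x : M) (k : Fin m) (S : Finset (Fin m)) (hk : k ∉ S) :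
    f (Function.update (fun j => if j ∈ S then w j - x else w j) k x) =
      f (Function.update w k x) := by
  classical
  induction S using Finset.induction_on with
  | empty => simp
  | insert j S hj ih =>
    simp only [Finset.mem_insert, not_or] at hk
    have h1 : Function.update (fun l => if l ∈ insert j S then w l - x else w l) k x =
        Function.update (Function.update (fun l => if l ∈ S then w l - x else w l) k x) j
          (w j - x) := by
      funext l
      by_cases h : l = j
      · subst h; simp [Ne.symm hk.1]
      · by_cases h' : l = k
        · subst h'; simp [h]
        · simp [h, h']
    rw [h1, f.map_update_sub]
    have h2 : Function.update (Function.update (fun l => if l ∈ S then w l - x else w l) k x) j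
        (w j) = Function.update (fun l => if l ∈ S then w l - x else w l) k x := by
      funext l
      by_cases h : l = j
      · subst h; simp [Ne.symm hk.1, hj]
      · simp [h]
    rw [h2, ih hk.2, sub_eq_self]
    refine f.map_eq_zero_of_eq _ (i := k) (j := j) ?_ hk.1
    simp [hk.1]

lemma alt_sub {M : Type*} [AddCommGroup M] [Module ℂ M] {m : ℕ} (f : M [⋀^Fin m]→ₗ[ℂ] ℂ)
    (w : Fin m → M) (x : M) (S : Finset (Fin m)) :
    f (fun j => if j ∈ S then w j - x else w j) =
      f w - ∑ k ∈ S, f (Function.update w k x) := by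
  classical
  induction S using Finset.induction_on with
  | empty => simp
  | insert j S hj ih =>
    have h1 : (fun l => if l ∈ insert j S then w l - x else w l) =
        Function.update (fun l => if l ∈ S then w l - x else w l) j (w j - x) := by
      funext l
      by_cases h : l = j
      · subst h; simp
      · simp [h]
    have h2 : Function.update (fun l => if l ∈ S then w l - x else w l) j (w j) =
        (fun l => if l ∈ S then w l - x else w l) := by
      funext l
      by_cases h : l = j
      · subst h; simp [hj]
      · simp [h]
    rw [h1, f.map_update_sub, h2, ih, alt_update f w x j S hj, Finset.sum_insert hj]
    ring

lemma altTr_face {m : ℕ} (b : Matrix (Fin N) (Fin N) ℂ)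
    (a : Fin (m + 1) → Matrix (Fin N) (Fin N) ℂ) :
    altTr b (fun k : Fin m => a k.succ - a 0) =
      ∑ i : Fin (m + 1), (-1 : ℂ) ^ (i : ℕ) * altTr b (fun k => a (i.succAbove k)) := by
  simp_rw [← altAM_apply]
  have := alt_sub (altAM m b) (fun k : Fin m => a k.succ) (a 0) Finset.univ
  simp only [Finset.mem_univ, if_true] at this
  rw [this, Fin.sum_univ_succ, sub_eq_add_neg, ← Finset.sum_neg_distrib]
  congr 1
  · simp
  · refine Finset.sum_congr rfl fun k _ => ?_
    obtain _ | m := m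
    · exact k.elim0
    have h1 : Function.update (fun k : Fin (m + 1) => a k.succ) k (a 0) =
        k.insertNth (a 0) (fun l : Fin m => a (k.succAbove l).succ) := by
      funext j
      refine Fin.succAboveCases k ?_ (fun l => ?_) j <;> simp
    have h2 : (fun l : Fin (m + 1) => a (k.succ.succAbove l)) =
        Matrix.vecCons (a 0) (fun l : Fin m => a (k.succAbove l).succ) := by
      funext j
      refine Fin.cases ?_ (fun l => ?_) j <;> simp
    rw [h1, h2, AlternatingMap.map_insertNth, Fin.val_succ, pow_succ]
    simp

lemma hasDerivWithinAt_wp {m : ℕ} {a : Fin m → ℝ → Matrix (Fin N) (Fin N) ℂ}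
    {a' : Fin m → Matrix (Fin N) (Fin N) ℂ} {s : Set ℝ} {x : ℝ}
    (ha : ∀ i, HasDerivWithinAt (a i) (a' i) s x) :
    HasDerivWithinAt (fun τ => wp (fun i => a i τ))
      (∑ k, wp (Function.update (fun i => a i x) k (a' k))) s x := by
  have h1 := (ContinuousMultilinearMap.mkPiAlgebraFin ℝ m
    (Matrix (Fin N) (Fin N) ℂ)).hasFDerivAt (x := fun i => a i x)
  have h2 : HasDerivWithinAt (fun τ => (fun i => a i τ)) a' s x := hasDerivWithinAt_pi.2 ha
  have h3 := h1.comp_hasDerivWithinAt x h2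
  rw [ContinuousMultilinearMap.linearDeriv_apply] at h3
  simpa only [Function.comp_def, ContinuousMultilinearMap.mkPiAlgebraFin_apply, List.ofFn_eq_map,
    ← wp.eq_1] using h3

lemma hasDerivWithinAt_altTr {m : ℕ} {b : ℝ → Matrix (Fin N) (Fin N) ℂ}
    {b' : Matrix (Fin N) (Fin N) ℂ} {a : Fin m → ℝ → Matrix (Fin N) (Fin N) ℂ}
    {a' : Fin m → Matrix (Fin N) (Fin N) ℂ} {s : Set ℝ} {x : ℝ}
    (hb : HasDerivWithinAt b b' s x)
    (ha : ∀ i, HasDerivWithinAt (a i) (a' i) s x) :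
    HasDerivWithinAt (fun τ => altTr (b τ) (fun i => a i τ))
      (altTr b' (fun i => a i x) + altTr2 (b x) (fun i => a i x) a') s x := by
  unfold altTr altTr2
  rw [← Finset.sum_add_distrib]
  refine HasDerivWithinAt.fun_sum fun σ _ => ?_
  rw [← mul_add, ← Matrix.trace_add]
  refine HasDerivWithinAt.const_mul _ ?_
  have h1 := hb.mul (hasDerivWithinAt_wp (fun i => ha (σ i)))
  exact ((Matrix.traceLinearMap (Fin N) ℝ ℂ).toContinuousLinearMap.hasFDerivAt).comp_hasDerivWithinAt
    x h1

lemma continuous_altTr {m : ℕ} : Continuous (fun p : Matrix (Fin N) (Fin N) ℂ ×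
    (Fin m → Matrix (Fin N) (Fin N) ℂ) => altTr p.1 p.2) := by
  unfold altTr wp
  refine continuous_finsetSum _ fun σ _ => continuous_const.mul ?_
  refine Continuous.matrix_trace (continuous_fst.mul ?_)
  exact continuous_list_prod _ fun i _ => by fun_prop

lemma continuous_altTr2 {m : ℕ} : Continuous (fun p : Matrix (Fin N) (Fin N) ℂ ×
    (Fin m → Matrix (Fin N) (Fin N) ℂ) × (Fin m → Matrix (Fin N) (Fin N) ℂ) =>
      altTr2 p.1 p.2.1 p.2.2) := by
  unfold altTr2 wp
  refine continuous_finsetSum _ fun σ _ => continuous_const.mul ?_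
  refine Continuous.matrix_trace (continuous_fst.mul ?_)
  refine continuous_finsetSum _ fun k _ => ?_
  refine continuous_list_prod _ fun i _ => ?_
  by_cases h : i = k
  · subst h; simp only [Function.update_self]; fun_prop
  · simp only [Function.update_of_ne h]; fun_prop

lemma hasDerivWithinAt_inv_mul {V D : ℝ → Matrix (Fin N) (Fin N) ℂ}
    {V' D' : Matrix (Fin N) (Fin N) ℂ} {s : Set ℝ} {x : ℝ}
    (hV : HasDerivWithinAt V V' s x) (hD : HasDerivWithinAt D D' s x) (hu : IsUnit (V x)) :
    HasDerivWithinAt (fun τ => (V τ)⁻¹ * D τ)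
      ((V x)⁻¹ * D' - ((V x)⁻¹ * V') * ((V x)⁻¹ * D x)) s x := by
  obtain ⟨u, hu⟩ := hu
  have h1 := hasFDerivAt_ringInverse (𝕜 := ℝ) u
  rw [hu] at h1
  have h2 := (h1.comp_hasDerivWithinAt x hV).mul hD
  have h3 : ((↑u⁻¹ : Matrix (Fin N) (Fin N) ℂ)) = (V x)⁻¹ := by
    rw [← hu, Matrix.coe_units_inv]
  simp only [Function.comp_def, ← Matrix.nonsing_inv_eq_ringInverse, h3] at h2
  refine h2.congr_deriv ?_
  simp [mul_assoc]
  abel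

lemma isUnit_simplexComb {n : ℕ} {U : Fin (n + 1) → Matrix (Fin N) (Fin N) ℂ}
    (hU : ∀ j, U j ∈ Matrix.unitaryGroup (Fin N) ℂ) (hclose : ∀ k l, ‖U k - U l‖ < 1)
    {t : Fin n → ℝ} (ht : t ∈ simplexΔ n) : IsUnit (simplexComb U t) := by
  have hmem : simplexComb U t ∈ Metric.ball (U 0) 1 := by
    have := (convex_ball (U 0) 1).sum_mem (t := Finset.univ)
      (w := (Fin.cons (1 - ∑ i, t i) t : Fin (n + 1) → ℝ)) (z := U) ?_ ?_ ?_
    · rw [Fin.sum_univ_succ] at this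
      simp only [Fin.cons_zero, Fin.cons_succ] at this
      simpa only [simplexComb, Complex.coe_smul] using this
    · intro i _
      refine Fin.cases ?_ (fun i => ?_) i
      · simpa using ht.2
      · simpa using ht.1 i
    · rw [Fin.sum_univ_succ]; simp
    · intro i _
      rw [mem_ball_iff_norm]; exact hclose i 0
  rw [mem_ball_iff_norm'] at hmem
  have h1 : star (U 0) * U 0 = 1 := (Matrix.mem_unitaryGroup_iff'.1 (hU 0))
  have h2 : U 0 * star (U 0) = 1 := (Matrix.mem_unitaryGroup_iff.1 (hU 0))
  have h3 : ‖star (U 0) * (U 0 - simplexComb U t)‖ < 1 := by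
    rwa [CStarRing.norm_mem_unitary_mul _ (Unitary.star_mem (hU 0))]
  have h4 := isUnit_one_sub_of_norm_lt_one h3
  have h5 : simplexComb U t = U 0 * (1 - star (U 0) * (U 0 - simplexComb U t)) := by
    rw [mul_sub, mul_one, ← mul_assoc, h2, one_mul]; abel
  rw [h5]
  exact (IsUnit.mul ⟨⟨U 0, star (U 0), h2, h1⟩, rfl⟩ h4)

end ChTrans

namespace ChTrans

lemma isClosed_simplexΔ (n : ℕ) : IsClosed (simplexΔ n) := by
  have : simplexΔ n = (⋂ i, {t : Fin n → ℝ | 0 ≤ t i}) ∩ {t | ∑ i, t i ≤ 1} := by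
    ext t; simp [simplexΔ]
  rw [this]
  refine IsClosed.inter (isClosed_iInter fun i => ?_) ?_
  · exact isClosed_le continuous_const (continuous_apply i)
  · exact isClosed_le (by fun_prop) continuous_const

lemma isCompact_simplexΔ (n : ℕ) : IsCompact (simplexΔ n) := by
  refine (isCompact_Icc (a := (0 : Fin n → ℝ)) (b := 1)).of_isClosed_subset (isClosed_simplexΔ n) ?_
  intro t ht
  refine ⟨fun i => ht.1 i, fun i => ?_⟩
  exact (Finset.single_le_sum (f := t) (fun j _ => ht.1 j) (Finset.mem_univ i)).trans ht.2

lemma measurableSet_simplexΔ (n : ℕ) : MeasurableSet (simplexΔ n) :=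
  (isClosed_simplexΔ n).measurableSet

lemma insertNth_mem {m : ℕ} (i : Fin (m + 1)) (x : ℝ) (s : Fin m → ℝ) :
    (i.insertNth x s : Fin (m + 1) → ℝ) ∈ simplexΔ (m + 1) ↔
      s ∈ simplexΔ m ∧ x ∈ Set.Icc 0 (1 - ∑ j, s j) := by
  unfold simplexΔ
  simp only [Set.mem_ofPred_eq, Set.mem_Icc]
  rw [Fin.forall_iff_succAbove i, Fin.sum_univ_succAbove _ i]
  simp only [Fin.insertNth_apply_same, Fin.insertNth_apply_succAbove]
  constructor
  · rintro ⟨⟨h1, h2⟩, h3⟩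
    exact ⟨⟨h2, by linarith⟩, h1, by linarith⟩
  · rintro ⟨⟨h1, h2⟩, h3, h4⟩
    exact ⟨⟨h3, h1⟩, by linarith⟩

lemma simplex_fubini {m : ℕ} (i : Fin (m + 1)) (f : (Fin (m + 1) → ℝ) → ℂ)
    (hf : IntegrableOn f (simplexΔ (m + 1))) :
    ∫ t in simplexΔ (m + 1), f t =
      ∫ s in simplexΔ m, ∫ x in (0 : ℝ)..(1 - ∑ j, s j), f (i.insertNth x s) := by
  have mp := (volume_preserving_piFinSuccAbove (fun _ : Fin (m + 1) => ℝ) i).symm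
  rw [← integral_indicator (measurableSet_simplexΔ _), ← mp.integral_comp']
  have hIntg : Integrable (fun p : ℝ × (Fin m → ℝ) =>
      (simplexΔ (m + 1)).indicator f
        ((MeasurableEquiv.piFinSuccAbove (fun _ : Fin (m + 1) => ℝ) i).symm p))
      (volume.prod volume) := by
    have := (mp.integrable_comp_emb (MeasurableEquiv.measurableEmbedding _)
      (g := (simplexΔ (m + 1)).indicator f)).2
        ((integrable_indicator_iff (measurableSet_simplexΔ _)).2 hf)
    exact this
  rw [Measure.volume_eq_prod, integral_prod_symm _ hIntg,
    ← integral_indicator (measurableSet_simplexΔ _)]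
  congr 1
  funext s
  have key : ∀ x : ℝ, (simplexΔ (m + 1)).indicator f
      ((MeasurableEquiv.piFinSuccAbove (fun _ : Fin (m + 1) => ℝ) i).symm (x, s)) =
      (simplexΔ m).indicator (fun s => (Set.Icc 0 (1 - ∑ j, s j)).indicator
        (fun x => f (i.insertNth x s)) x) s := by
    intro x
    change (simplexΔ (m + 1)).indicator f (i.insertNth x s) = _
    have := insertNth_mem i x s
    by_cases h1 : s ∈ simplexΔ m
    · by_cases h2 : x ∈ Set.Icc 0 (1 - ∑ j, s j)
      · rw [Set.indicator_of_mem (this.2 ⟨h1, h2⟩), Set.indicator_of_mem h1,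
          Set.indicator_of_mem h2]
      · rw [Set.indicator_of_notMem (fun h => h2 (this.1 h).2), Set.indicator_of_mem h1,
          Set.indicator_of_notMem h2]
    · rw [Set.indicator_of_notMem (fun h => h1 (this.1 h).1), Set.indicator_of_notMem h1]
  simp_rw [key]
  by_cases h1 : s ∈ simplexΔ m
  · simp only [Set.indicator_of_mem h1]
    rw [integral_indicator measurableSet_Icc, intervalIntegral.integral_of_le
      (by have := h1.2; linarith), integral_Icc_eq_integral_Ioc]
  · simp only [Set.indicator_of_notMem h1, integral_zero]

lemma continuous_ins {X : Type*} [TopologicalSpace X] {m : ℕ} (i : Fin (m + 1)) {f : X → ℝ}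
    {g : X → Fin m → ℝ} (hf : Continuous f) (hg : Continuous g) :
    Continuous (fun x => (i.insertNth (f x) (g x) : Fin (m + 1) → ℝ)) := by
  refine continuous_pi fun j => ?_
  refine Fin.succAboveCases i ?_ (fun l => ?_) j
  · simpa using hf
  · simp only [Fin.insertNth_apply_succAbove]
    exact (continuous_apply l).comp hg

lemma continuous_insertNth_face {m : ℕ} (i : Fin (m + 1)) : Continuous (fun s : Fin m → ℝ =>
    (i.insertNth (1 - ∑ j, s j) s : Fin (m + 1) → ℝ)) :=
  continuous_ins i (by fun_prop) continuous_id

lemma continuous_insertNth_zero {m : ℕ} (i : Fin (m + 1)) : Continuous (fun s : Fin m → ℝ =>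
    (i.insertNth 0 s : Fin (m + 1) → ℝ)) :=
  continuous_ins i continuous_const continuous_id

lemma simplex_reindex {m : ℕ} (i : Fin (m + 1)) (h : (Fin (m + 1) → ℝ) → ℂ)
    (hc : ContinuousOn h (simplexΔ (m + 1))) :
    ∫ s in simplexΔ m, h (i.insertNth (1 - ∑ j, s j) s) =
      ∫ s in simplexΔ m, h ((0 : Fin (m + 1)).insertNth (1 - ∑ j, s j) s) := by
  have hIntg : ∀ i : Fin (m + 1), IntegrableOn (fun s : Fin m → ℝ =>
      h (i.insertNth (1 - ∑ j, s j) s)) (simplexΔ m) := by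
    intro i
    refine ContinuousOn.integrableOn_compact (isCompact_simplexΔ m) (hc.comp ?_ ?_)
    · exact (continuous_insertNth_face i).continuousOn
    · intro s hs
      exact (insertNth_mem i _ s).2 ⟨hs, by have := hs.2; simpa using this, le_rfl⟩
  refine Fin.cases rfl (fun k => ?_) i
  obtain _ | m := m
  · exact k.elim0
  rw [simplex_fubini 0 _ (hIntg k.succ), simplex_fubini k _ (hIntg 0)]
  refine setIntegral_congr_fun (measurableSet_simplexΔ m) fun s _ => ?_
  have := intervalIntegral.integral_comp_sub_left (a := 0) (b := 1 - ∑ j, s j) (fun x =>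
    h ((0 : Fin (m + 2)).insertNth (1 - ∑ j, (k.insertNth x s : Fin (m + 1) → ℝ) j)
      (k.insertNth x s : Fin (m + 1) → ℝ))) (1 - ∑ j, s j)
  simp only [sub_self, sub_zero] at this
  rw [← this]
  congr 1
  funext x
  congr 1
  have e1 : ∀ (k : Fin (m + 1)) (x : ℝ), ∑ j, (k.insertNth x s : Fin (m + 1) → ℝ) j
      = x + ∑ j, s j := by
    intro k x
    rw [Fin.sum_univ_succAbove _ k]; simp
  rw [e1, e1]
  funext j
  refine Fin.cases ?_ (fun j => ?_) j
  · rw [← Fin.succ_succAbove_zero k, Fin.insertNth_apply_succAbove]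
    simp
    ring
  · have e2 : ∀ (y : ℝ) (v : Fin (m + 1) → ℝ),
        ((0 : Fin (m + 2)).insertNth y v : Fin (m + 2) → ℝ) j.succ = v j := fun y v => by simp
    rw [e2]
    refine Fin.succAboveCases k ?_ (fun l => ?_) j
    · simp; ring
    · rw [← Fin.succ_succAbove_succ, Fin.insertNth_apply_succAbove]
      simp

/-- Integration of a partial derivative over the simplex. -/
lemma simplex_ftc {m : ℕ} (i : Fin (m + 1)) (g g' : (Fin (m + 1) → ℝ) → ℂ)
    (hg : ContinuousOn g (simplexΔ (m + 1))) (hg' : ContinuousOn g' (simplexΔ (m + 1)))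
    (hd : ∀ s : Fin m → ℝ, ∀ x : ℝ, (i.insertNth x s : Fin (m + 1) → ℝ) ∈ simplexΔ (m + 1) →
      HasDerivAt (fun x => g (i.insertNth x s)) (g' (i.insertNth x s)) x) :
    ∫ t in simplexΔ (m + 1), g' t =
      (∫ s in simplexΔ m, g ((0 : Fin (m + 1)).insertNth (1 - ∑ j, s j) s)) -
      ∫ s in simplexΔ m, g (i.insertNth 0 s) := by
  rw [simplex_fubini i _ (hg'.integrableOn_compact (isCompact_simplexΔ _)),
    ← simplex_reindex i g hg, ← integral_sub]
  · refine setIntegral_congr_fun (measurableSet_simplexΔ m) fun s hs => ?_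
    have h0 : (0 : ℝ) ≤ 1 - ∑ j, s j := by have := hs.2; linarith
    refine intervalIntegral.integral_eq_sub_of_hasDerivAt
      (f := fun x => g (i.insertNth x s)) (f' := fun x => g' (i.insertNth x s)) ?_ ?_
    · intro x hx
      rw [Set.uIcc_of_le h0] at hx
      exact hd s x ((insertNth_mem i x s).2 ⟨hs, hx⟩)
    · refine ContinuousOn.intervalIntegrable (hg'.comp ?_ ?_)
      · exact (continuous_ins i continuous_id continuous_const).continuousOn
      · intro x hx
        rw [Set.uIcc_of_le h0] at hx
        exact (insertNth_mem i x s).2 ⟨hs, hx⟩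
  · refine ContinuousOn.integrableOn_compact (isCompact_simplexΔ m) (hg.comp ?_ ?_)
    · exact (continuous_insertNth_face i).continuousOn
    · intro s hs
      exact (insertNth_mem i _ s).2 ⟨hs, by have := hs.2; simpa using this, le_rfl⟩
  · refine ContinuousOn.integrableOn_compact (isCompact_simplexΔ m) (hg.comp ?_ ?_)
    · exact (continuous_insertNth_zero i).continuousOn
    · intro s hs
      exact (insertNth_mem i _ s).2 ⟨hs, le_rfl, by have := hs.2; simpa using this⟩

end ChTrans

namespace ChTrans

variable {N : ℕ}

lemma intervalIntegrable_param {m : ℕ} {F : ℝ × (Fin m → ℝ) → ℂ}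
    (hF : ContinuousOn F (Set.Icc 0 1 ×ˢ simplexΔ m)) :
    IntervalIntegrable (fun τ => ∫ s in simplexΔ m, F (τ, s)) volume 0 1 := by
  have h1 : IntegrableOn F (Set.Icc 0 1 ×ˢ simplexΔ m) (volume.prod volume) :=
    hF.integrableOn_compact (isCompact_Icc.prod (isCompact_simplexΔ m))
  rw [IntegrableOn, ← Measure.prod_restrict] at h1
  have h2 := h1.integral_prod_left
  rw [intervalIntegrable_iff_integrableOn_Icc_of_le zero_le_one]
  exact h2

lemma swap_param {m : ℕ} {F : ℝ × (Fin m → ℝ) → ℂ}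
    (hF : ContinuousOn F (Set.Icc 0 1 ×ˢ simplexΔ m)) :
    ∫ s in simplexΔ m, ∫ τ in (0 : ℝ)..1, F (τ, s) =
      ∫ τ in (0 : ℝ)..1, ∫ s in simplexΔ m, F (τ, s) := by
  have h1 : IntegrableOn F (Set.Icc 0 1 ×ˢ simplexΔ m) (volume.prod volume) :=
    hF.integrableOn_compact (isCompact_Icc.prod (isCompact_simplexΔ m))
  rw [IntegrableOn, ← Measure.prod_restrict] at h1
  simp_rw [intervalIntegral.integral_of_le (zero_le_one' ℝ), ← integral_Icc_eq_integral_Ioc]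
  exact (integral_integral_swap (f := fun τ s => F (τ, s)) h1).symm

lemma simplexComb_insertNth {m : ℕ} (U : Fin (m + 2) → Matrix (Fin N) (Fin N) ℂ)
    (i : Fin (m + 1)) (x : ℝ) (s : Fin m → ℝ) :
    simplexComb U (i.insertNth x s) = simplexComb (fun j => U (i.succ.succAbove j)) s +
      x • (U i.succ - U 0) := by
  unfold simplexComb
  rw [Fin.sum_univ_succAbove _ i, Fin.sum_univ_succAbove _ i]
  simp only [Fin.insertNth_apply_same, Fin.insertNth_apply_succAbove, Fin.succ_succAbove_zero,
    Fin.succ_succAbove_succ, Complex.coe_smul]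
  module

lemma simplexComb_insertNth_zero {m : ℕ} (U : Fin (m + 2) → Matrix (Fin N) (Fin N) ℂ)
    (i : Fin (m + 1)) (s : Fin m → ℝ) :
    simplexComb (fun j => U (i.succ.succAbove j)) s = simplexComb U (i.insertNth 0 s) := by
  rw [simplexComb_insertNth]; simp

lemma simplexComb_face_zero {m : ℕ} (U : Fin (m + 2) → Matrix (Fin N) (Fin N) ℂ)
    (s : Fin m → ℝ) :
    simplexComb (fun j => U ((0 : Fin (m + 2)).succAbove j)) s =
      simplexComb U ((0 : Fin (m + 1)).insertNth (1 - ∑ j, s j) s) := by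
  unfold simplexComb
  rw [Fin.sum_univ_succ, Fin.sum_univ_succ]
  simp only [Fin.insertNth_zero, Fin.cons_zero, Fin.cons_succ, Complex.coe_smul,
    Fin.zero_succAbove]
  simp

lemma hasDerivAt_comb {m : ℕ} (U : Fin (m + 2) → Matrix (Fin N) (Fin N) ℂ)
    (i : Fin (m + 1)) (x : ℝ) (s : Fin m → ℝ) :
    HasDerivAt (fun x : ℝ => simplexComb U (i.insertNth x s)) (U i.succ - U 0) x := by
  simp_rw [simplexComb_insertNth]
  simpa using ((hasDerivAt_id x).smul_const (U i.succ - U 0)).const_add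
    (simplexComb (fun j => U (i.succ.succAbove j)) s)

lemma hasDerivWithinAt_comb {n : ℕ} {U : Fin (n + 1) → ℝ → Matrix (Fin N) (Fin N) ℂ}
    {U' : Fin (n + 1) → Matrix (Fin N) (Fin N) ℂ} {S : Set ℝ} {τ : ℝ}
    (h : ∀ j, HasDerivWithinAt (U j) (U' j) S τ) (t : Fin n → ℝ) :
    HasDerivWithinAt (fun τ => simplexComb (fun j => U j τ) t) (simplexComb U' t) S τ := by
  unfold simplexComb
  simp only [Complex.coe_smul]
  exact ((h 0).const_smul _).add (HasDerivWithinAt.fun_sum fun i _ => (h i.succ).const_smul _)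

lemma continuousOn_comb {X : Type*} [TopologicalSpace X] {n : ℕ}
    {U : Fin (n + 1) → X → Matrix (Fin N) (Fin N) ℂ} {t : X → Fin n → ℝ} {S : Set X}
    (hU : ∀ j, ContinuousOn (U j) S) (ht : ContinuousOn t S) :
    ContinuousOn (fun p => simplexComb (fun j => U j p) (t p)) S := by
  unfold simplexComb
  simp only [Complex.coe_smul]
  have ht' : ∀ i, ContinuousOn (fun p => t p i) S := fun i =>
    (continuous_apply i).comp_continuousOn ht
  have h0 : ContinuousOn (fun p => 1 - ∑ i, t p i) S :=
    continuousOn_const.sub (continuousOn_finsetSum _ fun i _ => ht' i)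
  have h1 : ContinuousOn (fun p => (1 - ∑ i, t p i) • U 0 p) S := h0.smul (hU 0)
  have h2 : ContinuousOn (fun p => ∑ i : Fin n, t p i • U i.succ p) S :=
    continuousOn_finsetSum _ fun i _ => (ht' i).smul (hU i.succ)
  exact h1.add h2

lemma continuousOn_inv {X : Type*} [TopologicalSpace X] {V : X → Matrix (Fin N) (Fin N) ℂ}
    {S : Set X} (hV : ContinuousOn V S) (hu : ∀ p ∈ S, IsUnit (V p)) :
    ContinuousOn (fun p => (V p)⁻¹) S := by
  intro p hp
  obtain ⟨u, hu⟩ := hu p hp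
  have h1 := NormedRing.inverse_continuousAt u
  rw [hu] at h1
  have := h1.comp_continuousWithinAt (hV p hp)
  simpa only [Function.comp_def, ← Matrix.nonsing_inv_eq_ringInverse] using this

lemma continuousOn_altTr {X : Type*} [TopologicalSpace X] {m : ℕ} {S : Set X}
    {b : X → Matrix (Fin N) (Fin N) ℂ} {a : Fin m → X → Matrix (Fin N) (Fin N) ℂ}
    (hb : ContinuousOn b S) (ha : ∀ i, ContinuousOn (a i) S) :
    ContinuousOn (fun p => altTr (b p) (fun i => a i p)) S := by
  have h : ContinuousOn (fun p => (b p, fun i => a i p)) S := hb.prodMk (continuousOn_pi.2 ha)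
  have h2 := (continuous_altTr (N := N) (m := m)).comp_continuousOn h
  exact h2

lemma continuousOn_altTr2 {X : Type*} [TopologicalSpace X] {m : ℕ} {S : Set X}
    {b : X → Matrix (Fin N) (Fin N) ℂ} {a a' : Fin m → X → Matrix (Fin N) (Fin N) ℂ}
    (hb : ContinuousOn b S) (ha : ∀ i, ContinuousOn (a i) S) (ha' : ∀ i, ContinuousOn (a' i) S) :
    ContinuousOn (fun p => altTr2 (b p) (fun i => a i p) (fun i => a' i p)) S := by
  have h : ContinuousOn (fun p => (b p, (fun i => a i p), (fun i => a' i p))) S :=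
    hb.prodMk ((continuousOn_pi.2 ha).prodMk (continuousOn_pi.2 ha'))
  have h2 := (continuous_altTr2 (N := N) (m := m)).comp_continuousOn h
  exact h2

lemma transgression_eq {m : ℕ} (W : Fin (m + 1) → ℝ → Matrix (Fin N) (Fin N) ℂ) (τ : ℝ)
    (q : (Fin m → ℝ) → ℂ)
    (h : ∀ t ∈ simplexΔ m, altTr ((simplexComb (fun j => W j τ) t)⁻¹ *
      derivWithin (fun s => simplexComb (fun j => W j s) t) (Set.Icc 0 1) τ)
      (fun i => (simplexComb (fun j => W j τ) t)⁻¹ * (W i.succ τ - W 0 τ)) = q t) :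
    transgression m N W τ =
      ((m + 1 : ℕ) : ℂ) * oddChernConst (m + 1) * ∫ t in simplexΔ m, q t := by
  rw [← setIntegral_congr_fun (measurableSet_simplexΔ m) h]
  unfold transgression altTr wp
  rfl

lemma chOdd_eq {n : ℕ} (U : Fin (n + 1) → Matrix (Fin N) (Fin N) ℂ) :
    chOdd n N U = oddChernConst n * ∫ t in simplexΔ n,
      altTr 1 (fun i => (simplexComb U t)⁻¹ * (U i.succ - U 0)) := by
  unfold chOdd altTr wp
  simp only [one_mul]

lemma altTr_zero_left {m : ℕ} (a : Fin m → Matrix (Fin N) (Fin N) ℂ) : altTr 0 a = 0 := by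
  simp [altTr]

set_option maxHeartbeats 1000000 in
theorem main {m : ℕ} (hm : Even m)
    (U : Fin (m + 2) → ℝ → Matrix (Fin N) (Fin N) ℂ)
    (hC1 : ∀ j, ContDiffOn ℝ 1 (U j) (Set.Icc 0 1))
    (hU : ∀ j, ∀ τ ∈ Set.Icc (0 : ℝ) 1, U j τ ∈ Matrix.unitaryGroup (Fin N) ℂ)
    (hclose : ∀ k l, ∀ τ ∈ Set.Icc (0 : ℝ) 1, ‖U k τ - U l τ‖ < 1) :
    chOdd (m + 1) N (fun j => U j 1) - chOdd (m + 1) N (fun j => U j 0) =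
      ∑ j : Fin (m + 2), ((-1 : ℂ) ^ (j : ℕ)) *
        ∫ τ in (0 : ℝ)..1, transgression m N (fun i => U (j.succAbove i)) τ := by
  classical
  set I : Set ℝ := Set.Icc 0 1 with hI
  have hI1 : (1 : ℝ) ∈ I := by simp [hI]
  have hI0 : (0 : ℝ) ∈ I := by simp [hI]
  let U' : Fin (m + 2) → ℝ → Matrix (Fin N) (Fin N) ℂ := fun j τ => derivWithin (U j) I τ
  have hUd : ∀ j, ∀ τ ∈ I, HasDerivWithinAt (U j) (U' j τ) I τ := fun j τ hτ =>
    ((hC1 j).differentiableOn one_ne_zero τ hτ).hasDerivWithinAt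
  have hUc : ∀ j, ContinuousOn (U j) I := fun j => (hC1 j).continuousOn
  have hU'c : ∀ j, ContinuousOn (U' j) I := fun j =>
    (hC1 j).continuousOn_derivWithin (uniqueDiffOn_Icc zero_lt_one) le_rfl
  let V : ℝ × (Fin (m + 1) → ℝ) → Matrix (Fin N) (Fin N) ℂ := fun p =>
    simplexComb (fun j => U j p.1) p.2
  let V1 : ℝ × (Fin (m + 1) → ℝ) → Matrix (Fin N) (Fin N) ℂ := fun p =>
    simplexComb (fun j => U' j p.1) p.2
  let Fa : Fin (m + 1) → ℝ × (Fin (m + 1) → ℝ) → Matrix (Fin N) (Fin N) ℂ := fun i p =>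
    (V p)⁻¹ * (U i.succ p.1 - U 0 p.1)
  let Fd : Fin (m + 1) → ℝ × (Fin (m + 1) → ℝ) → Matrix (Fin N) (Fin N) ℂ := fun i p =>
    (V p)⁻¹ * (U' i.succ p.1 - U' 0 p.1)
  let Fb : ℝ × (Fin (m + 1) → ℝ) → Matrix (Fin N) (Fin N) ℂ := fun p => (V p)⁻¹ * V1 p
  set K : Set (ℝ × (Fin (m + 1) → ℝ)) := I ×ˢ simplexΔ (m + 1) with hK
  have hunit : ∀ p ∈ K, IsUnit (V p) := fun p hp =>
    isUnit_simplexComb (fun j => hU j p.1 hp.1) (fun k l => hclose k l p.1 hp.1) hp.2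
  have cU : ∀ j, ContinuousOn (fun p : ℝ × (Fin (m + 1) → ℝ) => U j p.1) K := fun j =>
    (hUc j).comp continuousOn_fst fun p hp => hp.1
  have cU' : ∀ j, ContinuousOn (fun p : ℝ × (Fin (m + 1) → ℝ) => U' j p.1) K := fun j =>
    (hU'c j).comp continuousOn_fst fun p hp => hp.1
  have cV : ContinuousOn V K := continuousOn_comb cU continuousOn_snd
  have cV1 : ContinuousOn V1 K := continuousOn_comb cU' continuousOn_snd
  have cVi : ContinuousOn (fun p => (V p)⁻¹) K := continuousOn_inv cV hunit
  have cFa : ∀ i, ContinuousOn (Fa i) K := fun i => cVi.mul ((cU _).sub (cU _))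
  have cFd : ∀ i, ContinuousOn (Fd i) K := fun i => cVi.mul ((cU' _).sub (cU' _))
  have cFb : ContinuousOn Fb K := cVi.mul cV1
  let α : ℝ × (Fin (m + 1) → ℝ) → ℂ := fun p => altTr 1 (fun i => Fa i p)
  let H : ℝ × (Fin (m + 1) → ℝ) → ℂ := fun p =>
    altTr2 1 (fun i => Fa i p) (fun i => Fd i p - Fb p * Fa i p)
  let g : Fin (m + 1) → ℝ × (Fin (m + 1) → ℝ) → ℂ := fun i p =>
    altTr (Fb p) (fun k => Fa (i.succAbove k) p)
  let g' : Fin (m + 1) → ℝ × (Fin (m + 1) → ℝ) → ℂ := fun i p =>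
    altTr (Fd i p - Fa i p * Fb p) (fun k => Fa (i.succAbove k) p) +
      altTr2 (Fb p) (fun k => Fa (i.succAbove k) p) (fun k => -(Fa i p * Fa (i.succAbove k) p))
  have key : ∀ p, H p = ((m + 1 : ℕ) : ℂ) * ∑ i : Fin (m + 1), (-1 : ℂ) ^ (i : ℕ) * g' i p :=
    fun p => key_alg hm (Fb p) (fun i => Fa i p) (fun i => Fd i p)
  have cα : ContinuousOn α K := continuousOn_altTr continuousOn_const cFa
  have cH : ContinuousOn H K := continuousOn_altTr2 continuousOn_const cFa
    (fun i => (cFd i).sub (cFb.mul (cFa i)))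
  have cg : ∀ i, ContinuousOn (g i) K := fun i => continuousOn_altTr cFb (fun k => cFa _)
  have cg' : ∀ i, ContinuousOn (g' i) K := fun i =>
    (continuousOn_altTr ((cFd i).sub ((cFa i).mul cFb)) (fun k => cFa _)).add
    (continuousOn_altTr2 cFb (fun k => cFa _) (fun k => ((cFa i).mul (cFa _)).neg))
  -- the derivative in the `τ` direction
  have dα : ∀ t ∈ simplexΔ (m + 1), ∀ τ ∈ I,
      HasDerivWithinAt (fun τ => α (τ, t)) (H (τ, t)) I τ := by
    intro t ht τ hτ
    have h1 : HasDerivWithinAt (fun τ => V (τ, t)) (V1 (τ, t)) I τ :=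
      hasDerivWithinAt_comb (fun j => hUd j τ hτ) t
    have h2 : ∀ i, HasDerivWithinAt (fun τ => Fa i (τ, t))
        (Fd i (τ, t) - Fb (τ, t) * Fa i (τ, t)) I τ := fun i =>
      hasDerivWithinAt_inv_mul h1 ((hUd i.succ τ hτ).sub (hUd 0 τ hτ)) (hunit (τ, t) ⟨hτ, ht⟩)
    have h3 := hasDerivWithinAt_altTr
      (hasDerivWithinAt_const τ I (1 : Matrix (Fin N) (Fin N) ℂ)) h2
    rw [altTr_zero_left, zero_add] at h3
    exact h3
  -- the derivatives in the simplex directions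
  have dg : ∀ τ ∈ I, ∀ i : Fin (m + 1), ∀ s : Fin m → ℝ, ∀ x : ℝ,
      (i.insertNth x s : Fin (m + 1) → ℝ) ∈ simplexΔ (m + 1) →
      HasDerivAt (fun x => g i (τ, i.insertNth x s)) (g' i (τ, i.insertNth x s)) x := by
    intro τ hτ i s x hx
    rw [← hasDerivWithinAt_univ]
    have h1 : HasDerivWithinAt (fun x : ℝ => V (τ, i.insertNth x s)) (U i.succ τ - U 0 τ)
        Set.univ x := (hasDerivAt_comb (fun j => U j τ) i x s).hasDerivWithinAt
    have h1' : HasDerivWithinAt (fun x : ℝ => V1 (τ, i.insertNth x s)) (U' i.succ τ - U' 0 τ)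
        Set.univ x := (hasDerivAt_comb (fun j => U' j τ) i x s).hasDerivWithinAt
    have hu := hunit (τ, i.insertNth x s) ⟨hτ, hx⟩
    have h2 : HasDerivWithinAt (fun x : ℝ => Fb (τ, i.insertNth x s))
        (Fd i (τ, i.insertNth x s) - Fa i (τ, i.insertNth x s) * Fb (τ, i.insertNth x s))
        Set.univ x := hasDerivWithinAt_inv_mul h1 h1' hu
    have h3 : ∀ k, HasDerivWithinAt (fun x : ℝ => Fa (i.succAbove k) (τ, i.insertNth x s))
        (-(Fa i (τ, i.insertNth x s) * Fa (i.succAbove k) (τ, i.insertNth x s)))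
        Set.univ x := by
      intro k
      have := hasDerivWithinAt_inv_mul h1 (hasDerivWithinAt_const x Set.univ
        (U (i.succAbove k).succ τ - U 0 τ)) hu
      rw [mul_zero, zero_sub] at this
      exact this
    exact hasDerivWithinAt_altTr h2 h3
  -- the boundary terms
  let Q0 : ℝ → ℂ := fun τ => ∫ s in simplexΔ m, ∑ i : Fin (m + 1), (-1 : ℂ) ^ (i : ℕ) *
    g i (τ, (0 : Fin (m + 1)).insertNth (1 - ∑ j, s j) s)
  let Q : Fin (m + 1) → ℝ → ℂ := fun i τ => ∫ s in simplexΔ m, g i (τ, i.insertNth 0 s)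
  have mem_face : ∀ p : ℝ × (Fin m → ℝ), p ∈ I ×ˢ simplexΔ m →
      (p.1, ((0 : Fin (m + 1)).insertNth (1 - ∑ j, p.2 j) p.2 : Fin (m + 1) → ℝ)) ∈ K :=
    fun p hp => ⟨hp.1, (insertNth_mem _ _ _).2 ⟨hp.2, by have := hp.2.2; simpa using this, le_rfl⟩⟩
  have mem_zero : ∀ i : Fin (m + 1), ∀ p : ℝ × (Fin m → ℝ), p ∈ I ×ˢ simplexΔ m →
      (p.1, (i.insertNth 0 p.2 : Fin (m + 1) → ℝ)) ∈ K :=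
    fun i p hp => ⟨hp.1, (insertNth_mem _ _ _).2 ⟨hp.2, le_rfl, by have := hp.2.2; simpa using this⟩⟩
  have cface : ∀ i, ContinuousOn (fun p : ℝ × (Fin m → ℝ) =>
      g i (p.1, (0 : Fin (m + 1)).insertNth (1 - ∑ j, p.2 j) p.2)) (I ×ˢ simplexΔ m) := fun i =>
    (cg i).comp (continuous_fst.prodMk
      ((continuous_insertNth_face 0).comp continuous_snd)).continuousOn mem_face
  have czero : ∀ i, ContinuousOn (fun p : ℝ × (Fin m → ℝ) =>
      g i (p.1, i.insertNth 0 p.2)) (I ×ˢ simplexΔ m) := fun i =>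
    (cg i).comp (continuous_fst.prodMk
      ((continuous_insertNth_zero i).comp continuous_snd)).continuousOn (mem_zero i)
  have iQ0 : IntervalIntegrable Q0 volume 0 1 := intervalIntegrable_param
    (F := fun p => ∑ i : Fin (m + 1), (-1 : ℂ) ^ (i : ℕ) *
      g i (p.1, (0 : Fin (m + 1)).insertNth (1 - ∑ j, p.2 j) p.2))
    (continuousOn_finsetSum _ fun i _ => continuousOn_const.mul (cface i))
  have iQ : ∀ i, IntervalIntegrable (Q i) volume 0 1 := fun i => intervalIntegrable_param
    (F := fun p => g i (p.1, i.insertNth 0 p.2)) (czero i)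
  have sect : ∀ {k : ℕ} {F : ℝ × (Fin k → ℝ) → ℂ} {τ : ℝ}, τ ∈ I →
      ContinuousOn F (I ×ˢ simplexΔ k) → ContinuousOn (fun t => F (τ, t)) (simplexΔ k) := by
    intro k F τ hτ hF
    exact hF.comp (continuous_const.prodMk continuous_id).continuousOn fun t ht => ⟨hτ, ht⟩
  have isect : ∀ {k : ℕ} {F : ℝ × (Fin k → ℝ) → ℂ} {τ : ℝ}, τ ∈ I →
      ContinuousOn F (I ×ˢ simplexΔ k) → IntegrableOn (fun t => F (τ, t)) (simplexΔ k) := by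
    intro k F τ hτ hF
    exact (sect hτ hF).integrableOn_compact (isCompact_simplexΔ k)
  -- Stokes
  have stokes : ∀ τ ∈ I, ∫ t in simplexΔ (m + 1), H (τ, t) =
      ((m + 1 : ℕ) : ℂ) * (Q0 τ - ∑ i : Fin (m + 1), (-1 : ℂ) ^ (i : ℕ) * Q i τ) := by
    intro τ hτ
    simp_rw [key]
    rw [integral_const_mul, integral_finsetSum _ fun i _ => (isect hτ (cg' i)).const_mul _]
    congr 1
    have hq : Q0 τ = ∑ i : Fin (m + 1), (-1 : ℂ) ^ (i : ℕ) * ∫ s in simplexΔ m,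
        g i (τ, (0 : Fin (m + 1)).insertNth (1 - ∑ j, s j) s) := by
      simp only [Q0]
      rw [integral_finsetSum _ fun i _ => (isect hτ (cface i)).const_mul _]
      exact Finset.sum_congr rfl fun i _ => integral_const_mul _ _
    rw [hq, ← Finset.sum_sub_distrib]
    refine Finset.sum_congr rfl fun i _ => ?_
    rw [integral_const_mul, simplex_ftc i (fun t => g i (τ, t)) (fun t => g' i (τ, t))
      (sect hτ (cg i)) (sect hτ (cg' i)) (dg τ hτ i), mul_sub]
  -- the transgression terms
  have T0 : ∀ τ ∈ I, transgression m N (fun i => U ((0 : Fin (m + 2)).succAbove i)) τ =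
      ((m + 1 : ℕ) : ℂ) * oddChernConst (m + 1) * Q0 τ := by
    intro τ hτ
    refine transgression_eq _ τ _ fun s hs => ?_
    have hd : derivWithin (fun r => simplexComb (fun j => U ((0 : Fin (m + 2)).succAbove j) r) s)
        (Set.Icc 0 1) τ = V1 (τ, (0 : Fin (m + 1)).insertNth (1 - ∑ j, s j) s) := by
      rw [(hasDerivWithinAt_comb (fun j => hUd ((0 : Fin (m + 2)).succAbove j) τ hτ)
        s).derivWithin (uniqueDiffOn_Icc zero_lt_one τ hτ)]
      exact simplexComb_face_zero (fun j => U' j τ) s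
    have hv := simplexComb_face_zero (fun j => U j τ) s
    have hf := altTr_face (Fb (τ, (0 : Fin (m + 1)).insertNth (1 - ∑ j, s j) s))
      (fun i => Fa i (τ, (0 : Fin (m + 1)).insertNth (1 - ∑ j, s j) s))
    refine Eq.trans ?_ hf
    rw [hd, hv]
    simp only [Fa, Fb, V, Fin.zero_succAbove, ← mul_sub, sub_sub_sub_cancel_right]
  have T1 : ∀ i : Fin (m + 1), ∀ τ ∈ I, transgression m N (fun k => U (i.succ.succAbove k)) τ =
      ((m + 1 : ℕ) : ℂ) * oddChernConst (m + 1) * Q i τ := by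
    intro i τ hτ
    refine transgression_eq _ τ _ fun s hs => ?_
    have hd : derivWithin (fun r => simplexComb (fun j => U (i.succ.succAbove j) r) s)
        (Set.Icc 0 1) τ = V1 (τ, i.insertNth 0 s) := by
      rw [(hasDerivWithinAt_comb (fun j => hUd (i.succ.succAbove j) τ hτ)
        s).derivWithin (uniqueDiffOn_Icc zero_lt_one τ hτ)]
      exact simplexComb_insertNth_zero (fun j => U' j τ) i s
    have hv := simplexComb_insertNth_zero (fun j => U j τ) i s
    rw [hd, hv]
    simp only [g, Fa, Fb, V, Fin.succ_succAbove_zero, Fin.succ_succAbove_succ]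
  have huI : Set.uIcc (0 : ℝ) 1 = I := Set.uIcc_of_le zero_le_one
  rw [Fin.sum_univ_succ]
  rw [intervalIntegral.integral_congr (g := fun τ =>
    ((m + 1 : ℕ) : ℂ) * oddChernConst (m + 1) * Q0 τ) (fun τ hτ => T0 τ (huI ▸ hτ)),
    intervalIntegral.integral_const_mul]
  have hsum : ∀ i : Fin (m + 1), ∫ τ in (0 : ℝ)..1,
      transgression m N (fun k => U (i.succ.succAbove k)) τ =
      ((m + 1 : ℕ) : ℂ) * oddChernConst (m + 1) * ∫ τ in (0 : ℝ)..1, Q i τ := fun i => by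
    rw [intervalIntegral.integral_congr (g := fun τ =>
      ((m + 1 : ℕ) : ℂ) * oddChernConst (m + 1) * Q i τ) (fun τ hτ => T1 i τ (huI ▸ hτ)),
      intervalIntegral.integral_const_mul]
  simp_rw [hsum]
  have hch : ∀ τ ∈ I, chOdd (m + 1) N (fun j => U j τ) =
      oddChernConst (m + 1) * ∫ t in simplexΔ (m + 1), α (τ, t) := by
    intro τ hτ
    exact chOdd_eq _
  rw [hch 1 hI1, hch 0 hI0, ← mul_sub, ← integral_sub (isect hI1 cα) (isect hI0 cα)]
  have hftc : ∫ t in simplexΔ (m + 1), (α (1, t) - α (0, t)) =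
      ∫ t in simplexΔ (m + 1), ∫ τ in (0 : ℝ)..1, H (τ, t) := by
    refine setIntegral_congr_fun (measurableSet_simplexΔ _) fun t ht => ?_
    symm
    refine intervalIntegral.integral_eq_sub_of_hasDerivAt_of_le (f := fun τ => α (τ, t))
      (f' := fun τ => H (τ, t)) zero_le_one ?_ ?_ ?_
    · exact fun τ hτ => (dα t ht τ hτ).continuousWithinAt
    · exact fun τ hτ => (dα t ht τ (Set.Ioo_subset_Icc_self hτ)).hasDerivAt
        (Icc_mem_nhds hτ.1 hτ.2)
    · refine ContinuousOn.intervalIntegrable ?_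
      rw [huI]
      exact cH.comp (continuous_id.prodMk continuous_const).continuousOn fun τ hτ => ⟨hτ, ht⟩
  have iQs : IntervalIntegrable (fun τ => ∑ i : Fin (m + 1), (-1 : ℂ) ^ (i : ℕ) * Q i τ)
      volume 0 1 := by
    have := IntervalIntegrable.sum (μ := volume) (a := 0) (b := 1) Finset.univ
      (f := fun (i : Fin (m + 1)) τ => (-1 : ℂ) ^ (i : ℕ) * Q i τ) fun i _ => (iQ i).const_mul _
    simpa only [Finset.sum_fn] using this
  rw [hftc, swap_param cH, intervalIntegral.integral_congr (fun τ hτ => stokes τ (huI ▸ hτ)),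
    intervalIntegral.integral_const_mul, intervalIntegral.integral_sub iQ0 iQs,
    intervalIntegral.integral_finsetSum fun i _ => (iQ i).const_mul _]
  simp_rw [intervalIntegral.integral_const_mul, Fin.val_succ, pow_succ]
  rw [mul_sub, mul_sub, sub_eq_add_neg, Finset.mul_sum, Finset.mul_sum, ← Finset.sum_neg_distrib]
  congr 1
  · simp; ring
  · exact Finset.sum_congr rfl fun i _ => by ring

end ChTrans

/-- for `n` odd and C¹ families of pairwise close unitaries, the difference
of the cocycles `Chⁿ` at the endpoints is the Alexander–Spanier coboundary of the
transgression `∫₀¹ T_τ dτ`. -/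
theorem chOdd_sub_chOdd_eq_coboundary
    (N n : ℕ) (hn : Odd n)
    (U : Fin (n + 1) → ℝ → Matrix (Fin N) (Fin N) ℂ)
    (hC1 : ∀ j, ContDiffOn ℝ 1 (U j) (Set.Icc 0 1))
    (hU : ∀ j, ∀ τ ∈ Set.Icc (0 : ℝ) 1, U j τ ∈ Matrix.unitaryGroup (Fin N) ℂ)
    (hclose : ∀ k l, ∀ τ ∈ Set.Icc (0 : ℝ) 1, ‖U k τ - U l τ‖ < 1) :
    chOdd n N (fun j => U j 1) - chOdd n N (fun j => U j 0) =
      ∑ j : Fin (n + 1), ((-1 : ℂ) ^ (j : ℕ)) *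
        ∫ τ in (0 : ℝ)..1,
          transgression (n - 1) N
            (fun i => U (j.succAbove (Fin.cast (Nat.succ_pred_eq_of_pos hn.pos) i))) τ := by
  obtain ⟨k, rfl⟩ := hn
  exact ChTrans.main (m := 2 * k) (even_two_mul k) U hC1 hU hclose
end

section
/- Let e be an N×N complex idempotent matrix (e² = e). Then λ·1 − e is invertible for all λ on the circle |λ − 1| = 1/2, and the Riesz projector of e associated to the eigenvalue 1 recovers e: (1/2πi) ∮_{|λ−1|=1/2} (λ·1 − e)⁻¹ dλ = e. -/
open scoped Matrix.Norms.L2Operator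

theorem riesz_aux_mul {N : ℕ} (e : Matrix (Fin N) (Fin N) ℂ) (he : e * e = e) (z : ℂ)
    (h0 : z ≠ 0) (h1 : z - 1 ≠ 0) :
    (z • (1 : Matrix (Fin N) (Fin N) ℂ) - e) * ((z - 1)⁻¹ • e + z⁻¹ • (1 - e)) = 1 := by
  have h2 : (z • (1 : Matrix (Fin N) (Fin N) ℂ) - e) * e = (z - 1) • e := by
    rw [sub_mul, he, smul_mul_assoc, one_mul, sub_smul, one_smul]
  have h3 : (z • (1 : Matrix (Fin N) (Fin N) ℂ) - e) * (1 - e) = z • (1 - e) := by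
    rw [mul_sub, h2, mul_one, sub_smul, smul_sub, one_smul]
    abel
  rw [mul_add, mul_smul_comm, mul_smul_comm, h2, h3, smul_smul, smul_smul,
    inv_mul_cancel₀ h1, inv_mul_cancel₀ h0, one_smul, one_smul]
  abel

theorem riesz_aux_ne {z : ℂ} (hz : ‖z - 1‖ ≤ 1 / 2) : z ≠ 0 := by
  rintro rfl
  norm_num at hz

theorem riesz_aux_ne' {z : ℂ} (hz : ‖z - 1‖ = 1 / 2) : z - 1 ≠ 0 := by
  intro h
  rw [h] at hz
  norm_num at hz

/-- for an idempotent matrix `e`, `λ·1 − e` is invertible on the circle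
`|λ−1| = 1/2` and the Riesz projector of `e` at the eigenvalue `1` recovers `e`. -/
theorem rieszProjector_of_idempotent
    (N : ℕ) (e : Matrix (Fin N) (Fin N) ℂ) (he : e * e = e) :
    (∀ z : ℂ, ‖z - 1‖ = 1 / 2 → IsUnit (z • (1 : Matrix (Fin N) (Fin N) ℂ) - e)) ∧
      (2 * Real.pi * Complex.I)⁻¹ •
          (∮ z in C(1, 1 / 2), (z • (1 : Matrix (Fin N) (Fin N) ℂ) - e)⁻¹) = e := by
  constructor
  · intro z hz
    have h := riesz_aux_mul e he z (riesz_aux_ne hz.le) (riesz_aux_ne' hz)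
    exact IsUnit.of_mul_eq_one _ h
  · have hR : (0 : ℝ) ≤ 1 / 2 := by norm_num
    have hc1 : ContinuousOn (fun z : ℂ => (z - 1)⁻¹) (Metric.sphere 1 (1 / 2)) := by
      refine ContinuousOn.inv₀ (by fun_prop) ?_
      intro z hz
      exact riesz_aux_ne' (mem_sphere_iff_norm.1 hz)
    have hd : DifferentiableOn ℂ (fun z : ℂ => z⁻¹) (Metric.closedBall 1 (1 / 2)) := by
      refine DifferentiableOn.inv (by fun_prop) ?_
      intro z hz
      exact riesz_aux_ne (mem_closedBall_iff_norm.1 hz)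
    have hc0 : ContinuousOn (fun z : ℂ => z⁻¹) (Metric.sphere 1 (1 / 2)) :=
      hd.continuousOn.mono Metric.sphere_subset_closedBall
    have hz0 : (∮ z in C(1, 1 / 2), (z : ℂ)⁻¹) = 0 := by
      refine DiffContOnCl.circleIntegral_eq_zero hR ?_
      refine DifferentiableOn.diffContOnCl ?_
      exact hd.mono Metric.closure_ball_subset_closedBall
    have hz1 : (∮ z in C(1, 1 / 2), ((z : ℂ) - 1)⁻¹) = 2 * Real.pi * Complex.I :=
      circleIntegral.integral_sub_center_inv 1 (by norm_num)
    have hcongr : (∮ z in C(1, 1 / 2), (z • (1 : Matrix (Fin N) (Fin N) ℂ) - e)⁻¹) =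
        ∮ z in C(1, 1 / 2), ((z - 1)⁻¹ • e + z⁻¹ • (1 - e)) := by
      refine circleIntegral.integral_congr hR ?_
      intro z hz
      have hz' := mem_sphere_iff_norm.1 hz
      exact Matrix.inv_eq_right_inv
        (riesz_aux_mul e he z (riesz_aux_ne hz'.le) (riesz_aux_ne' hz'))
    rw [hcongr, circleIntegral.integral_add
      (f := fun z : ℂ => (z - 1)⁻¹ • e) (g := fun z : ℂ => z⁻¹ • (1 - e))
      ((hc1.smul continuousOn_const).circleIntegrable hR)
      ((hc0.smul continuousOn_const).circleIntegrable hR),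
      circleIntegral.integral_smul_const, circleIntegral.integral_smul_const, hz0, hz1,
      zero_smul, add_zero, smul_smul, inv_mul_cancel₀ Complex.two_pi_I_ne_zero, one_smul]
end

section
/- Let e be an N×N complex idempotent matrix (e² = e), let δ be any N×N complex matrix, and let k ≥ 1 be an integer. Then (1/2πi) ∮_{|λ−1|=1/2} ((λ·1 − e)⁻¹ δ)^k (λ·1 − e)⁻¹ dλ = Σ_b (−1)^{m(b)−1} C(k−1, m(b)−1) · b₀ δ b₁ δ ⋯ δ b_k, where the sum runs over all functions b : {0,1,…,k} → {e, 1−e}, m(b) is the number of indices j with bⱼ = e, C is the binomial coefficient, and the terms with m(b) = 0 or m(b) > k are interpreted as 0. -/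
open scoped Matrix.Norms.L2Operator

/-- On the circle, `z ≠ 1` and `z ≠ 0`. -/
lemma sphere_ne {z : ℂ} (hz : z ∈ Metric.sphere (1 : ℂ) (1 / 2)) : z - 1 ≠ 0 ∧ z ≠ 0 := by
  rw [mem_sphere_iff_norm] at hz
  constructor
  · intro h
    rw [h] at hz
    norm_num at hz
  · rintro rfl
    norm_num at hz

lemma closedBall_ne {z : ℂ} (hz : z ∈ Metric.closedBall (1 : ℂ) (1 / 2)) : z ≠ 0 := by
  rw [mem_closedBall_iff_norm] at hz
  rintro rfl
  norm_num at hz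

lemma kernel_integrable (m n : ℕ) :
    CircleIntegrable (fun z : ℂ => (z - 1)⁻¹ ^ m * z⁻¹ ^ n) 1 (1 / 2) := by
  apply ContinuousOn.circleIntegrable (by norm_num)
  apply ContinuousOn.mul
  · exact ((continuousOn_id.sub continuousOn_const).inv₀ fun z hz => (sphere_ne hz).1).pow m
  · exact (continuousOn_id.inv₀ fun z hz => (sphere_ne hz).2).pow n

lemma kernel_zero (n : ℕ) :
    (∮ z in C(1, 1 / 2), (z - 1)⁻¹ ^ 0 * z⁻¹ ^ n) = 0 := by
  apply Complex.circleIntegral_eq_zero_of_differentiable_on_off_countable (by norm_num)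
    Set.countable_empty
  · simp only [pow_zero, one_mul]
    exact (continuousOn_id.inv₀ fun z hz => closedBall_ne hz).pow n
  · intro z hz
    have h0 : z ≠ 0 := closedBall_ne (Metric.ball_subset_closedBall hz.1)
    simp only [pow_zero, one_mul]
    exact (differentiableAt_id.inv h0).pow n

lemma kernel_rec (m n : ℕ) :
    (∮ z in C(1, 1 / 2), (z - 1)⁻¹ ^ (m + 1) * z⁻¹ ^ (n + 1)) =
      (∮ z in C(1, 1 / 2), (z - 1)⁻¹ ^ (m + 1) * z⁻¹ ^ n) -
      (∮ z in C(1, 1 / 2), (z - 1)⁻¹ ^ m * z⁻¹ ^ (n + 1)) := by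
  rw [← circleIntegral.integral_sub (kernel_integrable _ _) (kernel_integrable _ _)]
  apply circleIntegral.integral_congr (by norm_num)
  intro z hz
  obtain ⟨h1, h0⟩ := sphere_ne hz
  have key : (z - 1)⁻¹ * z⁻¹ = (z - 1)⁻¹ - z⁻¹ := by
    field_simp
    ring
  calc (z - 1)⁻¹ ^ (m + 1) * z⁻¹ ^ (n + 1)
      = (z - 1)⁻¹ ^ m * z⁻¹ ^ n * ((z - 1)⁻¹ * z⁻¹) := by ring
    _ = _ := by rw [key]; ring

lemma kernel_val (n m : ℕ) :
    (∮ z in C(1, 1 / 2), (z - 1)⁻¹ ^ (m + 1) * z⁻¹ ^ n) =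
      (2 * Real.pi * Complex.I) * ((-1) ^ m * (Nat.choose (m + n - 1) m : ℂ)) := by
  induction n generalizing m with
  | zero =>
    cases m with
    | zero =>
      simp
    | succ m =>
      have h := circleIntegral.integral_sub_zpow_of_ne (n := -((m + 2 : ℕ) : ℤ))
        (by push_cast; omega) 1 1 (1 / 2)
      simp only [zpow_neg, zpow_natCast] at h
      simp only [pow_zero, mul_one, inv_pow]
      rw [h]
      simp
  | succ n ih =>
    induction m with
    | zero =>
      rw [kernel_rec, ih, kernel_zero]
      simp
    | succ m ihm =>
      rw [kernel_rec, ih, ihm]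
      have e1 : m + 1 + (n + 1) - 1 = (m + n) + 1 := by omega
      have e2 : m + 1 + n - 1 = m + n := by omega
      have e3 : m + (n + 1) - 1 = m + n := by omega
      rw [e1, e2, e3, Nat.choose_succ_succ]
      push_cast
      ring

lemma word_expand {N : ℕ} (δ : Matrix (Fin N) (Fin N) ℂ) (p : Bool → Matrix (Fin N) (Fin N) ℂ)
    (c : Bool → ℂ) (k : ℕ) :
    ((c true • p true + c false • p false) * δ) ^ k * (c true • p true + c false • p false) =
      ∑ b : Fin (k + 1) → Bool, (∏ j, c (b j)) •
        (p (b 0) * ((List.finRange k).map fun j => δ * p (b j.succ)).prod) := by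
  induction k with
  | zero =>
    rw [← (Equiv.funUnique (Fin 1) Bool).symm.sum_comp]
    simp
  | succ k ih =>
    rw [pow_succ', mul_assoc, ih, ← (Fin.consEquiv fun _ : Fin (k + 2) => Bool).sum_comp,
      Fintype.sum_prod_type]
    simp only [Fintype.sum_bool, Fin.consEquiv_apply, Fin.prod_univ_succ (n := k + 1),
      Fin.cons_zero, Fin.cons_succ, List.finRange_succ (n := k), List.map_cons, List.prod_cons,
      List.map_map, Function.comp_def, add_mul]
    rw [Finset.mul_sum, Finset.mul_sum]
    congr 1 <;>
    · refine Finset.sum_congr rfl fun b _ => ?_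
      simp only [smul_mul_assoc, mul_smul_comm, smul_smul, mul_assoc]
      rw [mul_comm (∏ j, c (b j))]

lemma resolvent_eq {N : ℕ} (e : Matrix (Fin N) (Fin N) ℂ) (he : e * e = e) {z : ℂ}
    (h1 : z - 1 ≠ 0) (h0 : z ≠ 0) :
    (z • (1 : Matrix (Fin N) (Fin N) ℂ) - e)⁻¹ = (z - 1)⁻¹ • e + z⁻¹ • (1 - e) := by
  apply Matrix.inv_eq_right_inv
  have a1 : (z • (1 : Matrix (Fin N) (Fin N) ℂ) - e) * e = (z - 1) • e := by
    rw [sub_mul, he, smul_mul_assoc, one_mul, sub_smul, one_smul]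
  have a2 : (z • (1 : Matrix (Fin N) (Fin N) ℂ) - e) * (1 - e) = z • (1 - e) := by
    rw [mul_sub, a1, mul_one, smul_sub, sub_smul, one_smul]
    abel
  rw [mul_add, mul_smul_comm, mul_smul_comm, a1, a2, smul_smul, smul_smul,
    inv_mul_cancel₀ h1, inv_mul_cancel₀ h0, one_smul, one_smul]
  abel

/-- explicit expansion of the contour integral
`(1/2πi) ∮_{|λ−1|=1/2} ((λ·1−e)⁻¹ δ)^k (λ·1−e)⁻¹ dλ` for an idempotent `e` as a sum, over
all words `b₀ δ b₁ δ ⋯ δ b_k` with each `bⱼ ∈ {e, 1−e}`, with coefficients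
`(−1)^{m−1} C(k−1, m−1)` where `m` is the number of factors equal to `e` (and the terms
with `m = 0` vanish). -/
theorem circleIntegral_resolvent_delta_expansion
    (N k : ℕ) (hk : 1 ≤ k)
    (e δ : Matrix (Fin N) (Fin N) ℂ) (he : e * e = e) :
    (2 * Real.pi * Complex.I)⁻¹ •
        (∮ z in C(1, 1 / 2),
          ((z • (1 : Matrix (Fin N) (Fin N) ℂ) - e)⁻¹ * δ) ^ k *
            (z • (1 : Matrix (Fin N) (Fin N) ℂ) - e)⁻¹) =
      ∑ b : Fin (k + 1) → Bool,
        (if (Finset.univ.filter fun j => b j = true).card = 0 then (0 : ℂ)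
         else
          (-1 : ℂ) ^ ((Finset.univ.filter fun j => b j = true).card - 1) *
            (Nat.choose (k - 1) ((Finset.univ.filter fun j => b j = true).card - 1) : ℂ)) •
          ((if b 0 then e else 1 - e) *
            ((List.finRange k).map fun j => δ * (if b j.succ then e else 1 - e)).prod) := by
  have hpi : (2 * Real.pi * Complex.I : ℂ) ≠ 0 := Complex.two_pi_I_ne_zero
  have hcongr : (∮ z in C(1, 1 / 2),
          ((z • (1 : Matrix (Fin N) (Fin N) ℂ) - e)⁻¹ * δ) ^ k *
            (z • (1 : Matrix (Fin N) (Fin N) ℂ) - e)⁻¹) =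
      ∮ z in C(1, 1 / 2), ∑ b : Fin (k + 1) → Bool,
        ((z - 1)⁻¹ ^ (Finset.univ.filter fun j => b j = true).card *
          z⁻¹ ^ (Finset.univ.filter fun j => ¬ b j = true).card) •
        ((if b 0 then e else 1 - e) *
            ((List.finRange k).map fun j => δ * (if b j.succ then e else 1 - e)).prod) := by
    apply circleIntegral.integral_congr (by norm_num)
    intro z hz
    obtain ⟨h1, h0⟩ := sphere_ne hz
    have h := word_expand δ (fun b => if b then e else 1 - e)
      (fun b => if b then (z - 1)⁻¹ else z⁻¹) k
    simp only [if_true, Bool.false_eq_true, if_false] at h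
    simp only [resolvent_eq e he h1 h0]
    rw [h]
    refine Finset.sum_congr rfl fun b _ => ?_
    rw [Finset.prod_ite, Finset.prod_const, Finset.prod_const]
  rw [hcongr, circleIntegral.integral_fun_sum, Finset.smul_sum]
  · refine Finset.sum_congr rfl fun b _ => ?_
    rw [circleIntegral.integral_smul_const, smul_smul]
    congr 1
    have hcard := Finset.card_filter_add_card_filter_not (s := (Finset.univ : Finset (Fin (k + 1))))
      (fun j => b j = true)
    rw [Finset.card_univ, Fintype.card_fin] at hcard
    generalize (Finset.univ.filter fun j => b j = true).card = m at hcard ⊢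
    generalize (Finset.univ.filter fun j => ¬ b j = true).card = n at hcard ⊢
    cases m with
    | zero => rw [kernel_zero]; simp
    | succ m =>
      have e1 : m + n - 1 = k - 1 := by omega
      rw [kernel_val, inv_mul_cancel_left₀ hpi, e1]
      simp
  · intro b _
    have h := kernel_integrable (Finset.univ.filter fun j => b j = true).card
      (Finset.univ.filter fun j => ¬ b j = true).card
    unfold CircleIntegrable at h ⊢
    exact ⟨MeasureTheory.Integrable.smul_const h.1 _, MeasureTheory.Integrable.smul_const h.2 _⟩
end

section
/- Let a : I → M_N(ℂ) be a differentiable matrix-valued function on an open interval I such that for every s ∈ I the matrix λ·1 − a(s) is invertible for all λ on the circle |λ − 1| = 1/2. Then the Riesz projector P(s) = (1/2πi) ∮_{|λ−1|=1/2} (λ·1 − a(s))⁻¹ dλ is differentiable in s, with derivative P′(s) = (1/2πi) ∮_{|λ−1|=1/2} (λ·1 − a(s))⁻¹ a′(s) (λ·1 − a(s))⁻¹ dλ. -/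
open scoped Matrix.Norms.L2Operator

open Filter Topology in
theorem riesz_resolvent_continuous {N : ℕ} {X : Type*} [TopologicalSpace X]
    (f : X → Matrix (Fin N) (Fin N) ℂ) (S : Set X) (hf : ContinuousOn f S)
    (hu : ∀ p ∈ S, IsUnit (f p)) : ContinuousOn (fun p => (f p)⁻¹) S := by
  intro p hp
  obtain ⟨u, hu'⟩ := hu p hp
  have h1 : ContinuousAt (Ring.inverse : Matrix (Fin N) (Fin N) ℂ → _) (f p) := by
    rw [← hu']
    exact NormedRing.inverse_continuousAt u
  have h2 := h1.comp_continuousWithinAt (hf p hp)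
  refine h2.congr (fun q _ => ?_) ?_
  · exact Matrix.nonsing_inv_eq_ringInverse _
  · exact Matrix.nonsing_inv_eq_ringInverse _

theorem riesz_inv_sub_inv {N : ℕ} (A B : Matrix (Fin N) (Fin N) ℂ)
    (hA : IsUnit A) (hB : IsUnit B) : A⁻¹ - B⁻¹ = A⁻¹ * (B - A) * B⁻¹ := by
  have h1 : A⁻¹ * A = 1 := Matrix.nonsing_inv_mul A ((Matrix.isUnit_iff_isUnit_det A).1 hA)
  have h2 : B * B⁻¹ = 1 := Matrix.mul_nonsing_inv B ((Matrix.isUnit_iff_isUnit_det B).1 hB)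
  rw [mul_sub, sub_mul, h1, one_mul, mul_assoc, h2, mul_one]

open Filter Topology in
/-- differentiability of the Riesz projector
`P(s) = (1/2πi) ∮_{|λ−1|=1/2} (λ·1 − a(s))⁻¹ dλ` of a differentiable matrix family `a` on an
open interval, with
`P′(s) = (1/2πi) ∮_{|λ−1|=1/2} (λ·1 − a(s))⁻¹ a′(s) (λ·1 − a(s))⁻¹ dλ`. -/
theorem rieszProjector_hasDerivAt
    (N : ℕ) (x y : ℝ) (a : ℝ → Matrix (Fin N) (Fin N) ℂ)
    (hdiff : ∀ s ∈ Set.Ioo x y, DifferentiableAt ℝ a s)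
    (hinv : ∀ s ∈ Set.Ioo x y, ∀ z : ℂ, ‖z - 1‖ = 1 / 2 →
      IsUnit (z • (1 : Matrix (Fin N) (Fin N) ℂ) - a s)) :
    ∀ s ∈ Set.Ioo x y,
      HasDerivAt
        (fun r : ℝ =>
          (2 * Real.pi * Complex.I)⁻¹ •
            ∮ z in C(1, 1 / 2), (z • (1 : Matrix (Fin N) (Fin N) ℂ) - a r)⁻¹)
        ((2 * Real.pi * Complex.I)⁻¹ •
          ∮ z in C(1, 1 / 2),
            (z • (1 : Matrix (Fin N) (Fin N) ℂ) - a s)⁻¹ * deriv a s *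
              (z • (1 : Matrix (Fin N) (Fin N) ℂ) - a s)⁻¹) s := by
  intro s hs
  suffices hmain : HasDerivAt
      (fun r : ℝ => ∮ z in C(1, 1 / 2), (z • (1 : Matrix (Fin N) (Fin N) ℂ) - a r)⁻¹)
      (∮ z in C(1, 1 / 2), (z • (1 : Matrix (Fin N) (Fin N) ℂ) - a s)⁻¹ * deriv a s *
        (z • (1 : Matrix (Fin N) (Fin N) ℂ) - a s)⁻¹) s from
    hmain.const_smul ((2 * Real.pi * Complex.I)⁻¹ : ℂ)
  have hcirc : ∀ θ : ℝ, ‖circleMap 1 (1 / 2) θ - 1‖ = 1 / 2 := by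
    intro θ
    simp [circleMap]
  obtain ⟨δ, hδ, hsub⟩ := Metric.nhds_basis_closedBall.mem_iff.1 (isOpen_Ioo.mem_nhds hs)
  have hca : ContinuousOn a (Metric.closedBall s δ) := fun r hr =>
    (hdiff r (hsub hr)).continuousAt.continuousWithinAt
  -- joint continuity and uniform bound
  have hjoint : ContinuousOn (fun p : ℝ × ℝ =>
      (circleMap 1 (1 / 2) p.2 • (1 : Matrix (Fin N) (Fin N) ℂ) - a p.1)⁻¹)
      (Metric.closedBall s δ ×ˢ Set.uIcc 0 (2 * Real.pi)) := by
    apply riesz_resolvent_continuous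
    · refine ContinuousOn.sub ?_ (hca.comp continuousOn_fst fun p hp => hp.1)
      have : Continuous fun p : ℝ × ℝ => circleMap 1 (1 / 2) p.2 :=
        (continuous_circleMap 1 (1 / 2)).comp continuous_snd
      exact (this.smul continuous_const).continuousOn
    · intro p hp
      exact hinv _ (hsub hp.1) _ (hcirc _)
  obtain ⟨C, hC⟩ := ((isCompact_closedBall s δ).prod isCompact_uIcc).exists_bound_of_continuousOn
    hjoint
  have hres : ∀ r ∈ Metric.closedBall s δ, Continuous fun θ : ℝ =>
      (circleMap 1 (1 / 2) θ • (1 : Matrix (Fin N) (Fin N) ℂ) - a r)⁻¹ := by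
    intro r hr
    rw [← continuousOn_univ]
    apply riesz_resolvent_continuous
    · exact (((continuous_circleMap 1 (1 / 2)).smul continuous_const).sub
        continuous_const).continuousOn
    · intro θ _
      exact hinv _ (hsub hr) _ (hcirc _)
  have hcd : Continuous fun θ : ℝ => deriv (circleMap 1 (1 / 2)) θ := by
    simp only [deriv_circleMap]
    exact (continuous_circleMap 0 (1 / 2)).mul continuous_const
  have hsmem : s ∈ Metric.closedBall s δ := Metric.mem_closedBall_self hδ.le
  have hev : ∀ᶠ r in 𝓝[≠] s, r ∈ Metric.closedBall s δ :=
    mem_nhdsWithin_of_mem_nhds (Metric.closedBall_mem_nhds s hδ)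
  have hslope : Tendsto (slope a s) (𝓝[≠] s) (𝓝 (deriv a s)) :=
    hasDerivAt_iff_tendsto_slope.1 (hdiff s hs).hasDerivAt
  rw [hasDerivAt_iff_tendsto_slope]
  have key : Tendsto (fun r => ∫ θ in (0 : ℝ)..2 * Real.pi, deriv (circleMap 1 (1 / 2)) θ •
      ((circleMap 1 (1 / 2) θ • (1 : Matrix (Fin N) (Fin N) ℂ) - a r)⁻¹ * slope a s r *
        (circleMap 1 (1 / 2) θ • (1 : Matrix (Fin N) (Fin N) ℂ) - a s)⁻¹)) (𝓝[≠] s)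
      (𝓝 (∫ θ in (0 : ℝ)..2 * Real.pi, deriv (circleMap 1 (1 / 2)) θ •
      ((circleMap 1 (1 / 2) θ • (1 : Matrix (Fin N) (Fin N) ℂ) - a s)⁻¹ * deriv a s *
        (circleMap 1 (1 / 2) θ • (1 : Matrix (Fin N) (Fin N) ℂ) - a s)⁻¹))) := by
    apply intervalIntegral.tendsto_integral_filter_of_dominated_convergence
      (fun _ => 1 / 2 * (C * (‖deriv a s‖ + 1) * C))
    · filter_upwards [hev] with r hr
      exact (hcd.smul (((hres r hr).mul continuous_const).mul
        (hres s hsmem))).aestronglyMeasurable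
    · filter_upwards [hev, hslope.norm.eventually_le_const (lt_add_one _)] with r hr hb
      refine Eventually.of_forall fun θ hθ => ?_
      have hθ' := Set.uIoc_subset_uIcc hθ
      have e1 := hC (r, θ) ⟨hr, hθ'⟩
      have e2 := hC (s, θ) ⟨hsmem, hθ'⟩
      have hC0 : 0 ≤ C := (norm_nonneg _).trans e1
      have e3 : ‖deriv (circleMap 1 (1 / 2)) θ‖ = 1 / 2 := by
        simp [deriv_circleMap]
      rw [norm_smul, e3]
      refine mul_le_mul_of_nonneg_left ?_ (by norm_num)
      refine (norm_mul_le _ _).trans (mul_le_mul ?_ e2 (norm_nonneg _) (by positivity))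
      exact (norm_mul_le _ _).trans (mul_le_mul e1 hb (norm_nonneg _) hC0)
    · exact intervalIntegrable_const
    · refine Eventually.of_forall fun θ hθ => ?_
      have hθ' := Set.uIoc_subset_uIcc hθ
      have hc : ContinuousOn (fun r =>
          (circleMap 1 (1 / 2) θ • (1 : Matrix (Fin N) (Fin N) ℂ) - a r)⁻¹)
          (Metric.closedBall s δ) :=
        hjoint.comp (f := fun r => (r, θ)) (by fun_prop) fun r hr => ⟨hr, hθ'⟩
      have hc' := (hc.continuousAt (Metric.closedBall_mem_nhds s hδ)).tendsto.mono_left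
        (nhdsWithin_le_nhds (s := {s}ᶜ))
      exact ((hc'.mul hslope).mul tendsto_const_nhds).const_smul _
  refine Tendsto.congr' ?_ key
  filter_upwards [hev] with r hr
  have hi : ∀ r ∈ Metric.closedBall s δ, IntervalIntegrable (fun θ : ℝ =>
      deriv (circleMap 1 (1 / 2)) θ •
        (circleMap 1 (1 / 2) θ • (1 : Matrix (Fin N) (Fin N) ℂ) - a r)⁻¹)
      MeasureTheory.volume 0 (2 * Real.pi) := fun r hr =>
    (hcd.smul (hres r hr)).intervalIntegrable _ _
  simp only [circleIntegral, slope_def_module]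
  rw [← intervalIntegral.integral_sub (hi r hr) (hi s hsmem), ← intervalIntegral.integral_smul]
  refine intervalIntegral.integral_congr fun θ _ => ?_
  rw [← smul_sub, riesz_inv_sub_inv _ _ (hinv _ (hsub hr) _ (hcirc θ)) (hinv _ hs _ (hcirc θ)),
    sub_sub_sub_cancel_left, mul_smul_comm, smul_mul_assoc, smul_comm]
end
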